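/- Every jump game whose graph is a cylinder — the Cartesian product of a cycle C_m (m ≥ 3) with a single edge, i.e., a 2 × m grid whose rows are cycles — admits an equilibrium assignment. -/

import Mathlib

open Finset

variable {V : Type*} {A : Type*} {T : Type*}

/-- Utility of agent `i` under assignment `σ`: the number of distinct types,
different from `t i`, among the agents occupying nodes adjacent to `σ i`. -/
noncomputable def util (G : SimpleGraph V) (t : A → T) (σ : A ↪ V) (i : A) : ℕ :=
  {c : T | c ≠ t i ∧ ∃ j : A, G.Adj (σ i) (σ j) ∧ t j = c}.ncard

/-- Type-count of node `w` under assignment `σ`: the number of distinct types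
among the agents occupying nodes adjacent to `w`. -/
noncomputable def tauN (G : SimpleGraph V) (t : A → T) (σ : A ↪ V) (w : V) : ℕ :=
  {c : T | ∃ j : A, G.Adj w (σ j) ∧ t j = c}.ncard

/-- A node is empty under `σ` if no agent occupies it. -/
def IsEmptyNode (σ : A ↪ V) (w : V) : Prop := ∀ i : A, σ i ≠ w

/-- `σ'` is obtained from `σ` by an improving jump of agent `i`. -/
def ImpJump (G : SimpleGraph V) (t : A → T) (σ σ' : A ↪ V) (i : A) : Prop :=
  (∀ j : A, j ≠ i → σ' j = σ j) ∧ IsEmptyNode σ (σ' i) ∧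
    util G t σ i < util G t σ' i

/-- An assignment is an equilibrium if no agent has an improving jump. -/
def IsEquilibrium (G : SimpleGraph V) (t : A → T) (σ : A ↪ V) : Prop :=
  ∀ (σ' : A ↪ V) (i : A), ¬ ImpJump G t σ σ' i

/-- An improving response cycle: `f 0, f 1, …, f m` with `m ≥ 1`, `f m = f 0`,
and each step an improving jump of some agent. -/
def IsIRC (G : SimpleGraph V) (t : A → T) (m : ℕ) (f : ℕ → (A ↪ V)) : Prop :=
  1 ≤ m ∧ f m = f 0 ∧ ∀ ℓ < m, ∃ i : A, ImpJump G t (f ℓ) (f (ℓ + 1)) i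

/-- Social welfare: total utility of the agents. -/
noncomputable def socialWelfare [Fintype A] (G : SimpleGraph V) (t : A → T) (σ : A ↪ V) : ℕ :=
  ∑ i : A, util G t σ i

/-- Number of colorful edges: edges whose endpoints are occupied by agents of
different types. -/
noncomputable def colorfulEdges (G : SimpleGraph V) (t : A → T) (σ : A ↪ V) : ℕ :=
  {e ∈ G.edgeSet | ∃ i j : A, t i ≠ t j ∧ e = s(σ i, σ j)}.ncard

/-- The set of monochromatic edges: edges whose endpoints are occupied by agents
of the same type. -/
def monoEdgeSet (G : SimpleGraph V) (t : A → T) (σ : A ↪ V) : Set (Sym2 V) :=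
  {e ∈ G.edgeSet | ∃ i j : A, i ≠ j ∧ t i = t j ∧ e = s(σ i, σ j)}

/-- Number of monochromatic edges. -/
noncomputable def monoEdges (G : SimpleGraph V) (t : A → T) (σ : A ↪ V) : ℕ :=
  (monoEdgeSet G t σ).ncard

/-- `c(σ)`: the number of empty nodes adjacent to at most one type of agents. -/
noncomputable def emptyLowCount (G : SimpleGraph V) (t : A → T) (σ : A ↪ V) : ℕ :=
  {w : V | IsEmptyNode σ w ∧ tauN G t σ w ≤ 1}.ncard

/-- `TE(σ)`: the total type-count of the empty nodes. -/
noncomputable def totalEmptyTypeCount (G : SimpleGraph V) (t : A → T) (σ : A ↪ V) : ℕ :=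
  ∑ᶠ w ∈ {w : V | IsEmptyNode σ w}, tauN G t σ w

open Classical in
/-- `B(σ)`: 1 if two (distinct) empty nodes are adjacent, 0 otherwise. -/
noncomputable def adjEmptyIndicator (G : SimpleGraph V) (σ : A ↪ V) : ℕ :=
  if ∃ w₁ w₂ : V, IsEmptyNode σ w₁ ∧ IsEmptyNode σ w₂ ∧ G.Adj w₁ w₂ then 1 else 0

/-- `n_T`: the number of agents of type `c`. -/
noncomputable def typeCount (t : A → T) (c : T) : ℕ := {i : A | t i = c}.ncard

/-- The 2 × m cylinder graph: the Cartesian product of the cycle `C_m`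
(on `ZMod m`) with a single edge (`Fin 2`). -/
def cylinderGraph (m : ℕ) : SimpleGraph (ZMod m × Fin 2) :=
  SimpleGraph.fromRel (fun p q =>
    (p.1 = q.1 + 1 ∧ p.2 = q.2) ∨ (p.1 = q.1 ∧ p.2 ≠ q.2))


/-- `g` is the colouring (with `none` for empty nodes) of some assignment. -/
def Cfg {V A T : Type*} (t : A → T) (g : V → Option T) : Prop :=
  ∃ σ : A ↪ V, (∀ i, g (σ i) = some (t i)) ∧ ∀ v, g v ≠ none → ∃ i, σ i = v

/-- types other than `c` seen at `w` when the agent at `v` is ignored -/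
def seen {V T : Type*} (G : SimpleGraph V) (g : V → Option T) (v w : V) (c : T) : Set T :=
  {d | d ≠ c ∧ ∃ z, G.Adj w z ∧ z ≠ v ∧ g z = some d}

lemma equil_of {V A T : Type*} {G : SimpleGraph V} {t : A → T} {g : V → Option T}
    (hg : Cfg t g)
    (H : ∀ v w c, g v = some c → g w = none →
      (seen G g v w c).ncard ≤ (seen G g v v c).ncard) :
    ∃ σ : A ↪ V, IsEquilibrium G t σ := by
  obtain ⟨σ, h1, h2⟩ := hg
  refine ⟨σ, ?_⟩
  rintro σ' i ⟨k1, k2, k3⟩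
  have hn : g (σ' i) = none := by
    by_contra h
    obtain ⟨j, hj⟩ := h2 _ h
    exact k2 j hj
  have := H (σ i) (σ' i) (t i) (h1 i) hn
  have e1 : util G t σ i = (seen G g (σ i) (σ i) (t i)).ncard := by
    unfold util seen
    congr 1
    ext c
    simp only [Set.mem_ofPred_eq]
    constructor
    · rintro ⟨hc, j, hj, rfl⟩
      exact ⟨hc, σ j, hj, hj.ne', h1 j⟩
    · rintro ⟨hc, z, hz, hzv, hgz⟩
      obtain ⟨j, rfl⟩ := h2 z (by simp [hgz])
      refine ⟨hc, j, hz, ?_⟩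
      rw [h1 j] at hgz
      exact Option.some.inj hgz
  have e2 : util G t σ' i = (seen G g (σ i) (σ' i) (t i)).ncard := by
    unfold util seen
    congr 1
    ext c
    simp only [Set.mem_ofPred_eq]
    constructor
    · rintro ⟨hc, j, hj, rfl⟩
      have hji : j ≠ i := by rintro rfl; exact hj.ne rfl
      rw [k1 j hji] at hj
      exact ⟨hc, σ j, hj, fun h => hji (σ.injective h), h1 j⟩
    · rintro ⟨hc, z, hz, hzv, hgz⟩
      obtain ⟨j, rfl⟩ := h2 z (by simp [hgz])
      have hji : j ≠ i := by rintro rfl; exact hzv rfl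
      refine ⟨hc, j, ?_, ?_⟩
      · rw [k1 j hji]; exact hz
      · rw [h1 j] at hgz
        exact Option.some.inj hgz
  omega

lemma Cfg.perm {V A T : Type*} {t : A → T} {g : V → Option T} (hg : Cfg t g)
    (π : Equiv.Perm V) : Cfg t (g ∘ π) := by
  obtain ⟨σ, h1, h2⟩ := hg
  refine ⟨σ.trans π.symm.toEmbedding, ?_, ?_⟩
  · intro i; simp [h1]
  · intro v hv
    obtain ⟨i, hi⟩ := h2 (π v) hv
    exact ⟨i, by simp [hi]⟩

open Classical in
/-- number of agents of type `c` -/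
noncomputable def cnt {A T : Type*} [Fintype A] (t : A → T) (c : T) : ℕ :=
  (Finset.univ.filter (fun i => t i = c)).card

open Classical in
lemma Cfg.card_eq {V A T : Type*} [Fintype A] [Fintype V] {t : A → T} {g : V → Option T}
    (hg : Cfg t g) (c : T) :
    (Finset.univ.filter (fun v => g v = some c)).card = cnt t c := by
  obtain ⟨σ, h1, h2⟩ := hg
  unfold cnt
  rw [← Finset.card_map σ]
  congr 1
  ext v
  simp only [Finset.mem_filter, Finset.mem_univ, true_and, Finset.mem_map]
  constructor
  · intro hv
    obtain ⟨i, rfl⟩ := h2 v (by simp [hv])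
    rw [h1 i] at hv
    exact ⟨i, Option.some.inj hv, rfl⟩
  · rintro ⟨i, hi, rfl⟩
    rw [h1 i, hi]

lemma Cfg.le_cnt {V A T : Type*} [Fintype A] [Fintype V] {t : A → T} {g : V → Option T}
    (hg : Cfg t g) (c : T) (s : Finset V) (hs : ∀ v ∈ s, g v = some c) : s.card ≤ cnt t c := by
  classical
  rw [← hg.card_eq c]
  apply Finset.card_le_card
  intro v hv
  simpa using hs v hv

/-- If all `c`-agents are accounted for by `s`, other nodes are not `c`. -/
lemma Cfg.not_mem {V A T : Type*} [Fintype A] [Fintype V] {t : A → T} {g : V → Option T}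
    (hg : Cfg t g) (c : T) (s : Finset V) (hs : ∀ v ∈ s, g v = some c) (hc : cnt t c ≤ s.card)
    (v : V) (hv : v ∉ s) : g v ≠ some c := by
  classical
  intro h
  have := hg.le_cnt c (insert v s) (by
    intro u hu
    rcases Finset.mem_insert.1 hu with rfl | hu
    · exact h
    · exact hs u hu)
  rw [Finset.card_insert_of_notMem hv] at this
  omega

lemma exists_cfg {V A T : Type*} [Fintype A] [Fintype V] (t : A → T) (R : Finset V)
    (hR : R.card = Fintype.card A) : ∃ g : V → Option T, Cfg t g ∧ ∀ v, g v ≠ none ↔ v ∈ R := by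
  classical
  have e : A ≃ R := Fintype.equivOfCardEq (by simp [hR])
  refine ⟨fun v => if h : v ∈ R then some (t (e.symm ⟨v, h⟩)) else none,
    ⟨⟨fun i => (e i : V), fun i j h => e.injective (Subtype.ext h)⟩, ?_, ?_⟩, ?_⟩
  · intro i
    show (if h : ((e i : R) : V) ∈ R then some (t (e.symm ⟨(e i : V), h⟩)) else none) = some (t i)
    rw [dif_pos (e i).2]
    simp
  · intro v hv
    by_cases h : v ∈ R
    · refine ⟨e.symm ⟨v, h⟩, ?_⟩
      show ((e (e.symm ⟨v, h⟩) : R) : V) = v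
      simp
    · simp [h] at hv
  · intro v
    by_cases h : v ∈ R <;> simp [h]

/-- good configurations: occupied set `R`, demands `φ` -/
def Dem {V A T : Type*} (t : A → T) (R : Finset V) (φ : V → Option T) (g : V → Option T) : Prop :=
  Cfg t g ∧ (∀ v, g v ≠ none ↔ v ∈ R) ∧ ∀ v c, φ v = some c → g v = some c

lemma exists_max {X : Type*} [Finite X] (P : X → Prop) (h : ∃ x, P x) (f : X → ℕ) :
    ∃ x, P x ∧ ∀ y, P y → f y ≤ f x := by
  obtain ⟨x, hx, hm⟩ := Set.exists_max_image {x | P x} f (Set.toFinite _) h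
  exact ⟨x, hx, hm⟩

lemma occ_swap {V T : Type*} [DecidableEq V] {g : V → Option T} {R : Finset V}
    (h : ∀ v, g v ≠ none ↔ v ∈ R) {u v : V} (hu : u ∈ R) (hv : v ∈ R) :
    ∀ w, (g ∘ Equiv.swap u v) w ≠ none ↔ w ∈ R := by
  intro w
  simp only [Function.comp]
  rw [h]
  by_cases h1 : w = u
  · subst h1; simp [hu, hv]
  by_cases h2 : w = v
  · subst h2; simp [hu, hv]
  rw [Equiv.swap_apply_of_ne_of_ne h1 h2]

open Classical in
lemma exists_dem {V A T : Type*} [Fintype A] [Fintype V] [Finite T] (t : A → T) (R : Finset V)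
    (hR : R.card = Fintype.card A) (φ : V → Option T)
    (hφR : ∀ v, φ v ≠ none → v ∈ R)
    (hφ : ∀ c, (Finset.univ.filter (fun v => φ v = some c)).card ≤ cnt t c) :
    ∃ g, Dem t R φ g := by
  obtain ⟨g, ⟨hg, hgR⟩, hmax⟩ := exists_max
    (fun g : V → Option T => Cfg t g ∧ ∀ v, g v ≠ none ↔ v ∈ R) (exists_cfg t R hR)
    (fun g => (Finset.univ.filter (fun v => φ v ≠ none ∧ g v = φ v)).card)
  refine ⟨g, hg, hgR, ?_⟩
  intro v c hv
  by_contra hne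
  have : ∃ w, g w = some c ∧ φ w ≠ some c := by
    by_contra hcon
    push Not at hcon
    have h1 := hφ c
    rw [← hg.card_eq c] at h1
    have h2 : (Finset.univ.filter (fun v => g v = some c)) ⊂
        (Finset.univ.filter (fun v => φ v = some c)) := by
      refine Finset.ssubset_iff_subset_ne.2 ⟨?_, ?_⟩
      · intro w hw
        simp only [Finset.mem_filter, Finset.mem_univ, true_and] at hw ⊢
        exact hcon w hw
      · intro he
        have : v ∈ (Finset.univ.filter (fun v => g v = some c)) := by
          rw [he]; simpa using hv
        simp at this
        exact hne this
    have := Finset.card_lt_card h2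
    omega
  obtain ⟨w, hw, hw'⟩ := this
  have hvR := hφR v (by simp [hv])
  have hwR := (hgR w).1 (by simp [hw])
  have hm := hmax _ ⟨hg.perm (Equiv.swap v w), occ_swap hgR hvR hwR⟩
  refine absurd hm (not_le.2 (Finset.card_lt_card ?_))
  refine Finset.ssubset_iff_subset_ne.2 ⟨?_, ?_⟩
  · intro z hz
    simp only [Finset.mem_filter, Finset.mem_univ, true_and, Function.comp] at hz ⊢
    refine ⟨hz.1, ?_⟩
    have z1 : z ≠ v := by rintro rfl; rw [hv] at hz; exact hne hz.2
    have z2 : z ≠ w := by rintro rfl; rw [← hz.2] at hw'; exact hw' hw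
    rw [Equiv.swap_apply_of_ne_of_ne z1 z2]; exact hz.2
  · intro he
    have : v ∈ (Finset.univ.filter (fun z => φ z ≠ none ∧ g z = φ z)) := by
      rw [he]; simp [hv, hw]
    simp [hv] at this
    exact hne this

lemma Dem.swap {V A T : Type*} [DecidableEq V] {t : A → T} {R : Finset V} {φ g : V → Option T}
    (h : Dem t R φ g) {u v : V} (hu : u ∈ R) (hv : v ∈ R) (hu' : φ u = none) (hv' : φ v = none) :
    Dem t R φ (g ∘ Equiv.swap u v) := by
  refine ⟨h.1.perm _, occ_swap h.2.1 hu hv, ?_⟩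
  intro w c hw
  have z1 : w ≠ u := by rintro rfl; simp [hu'] at hw
  have z2 : w ≠ v := by rintro rfl; simp [hv'] at hw
  simp only [Function.comp]
  rw [Equiv.swap_apply_of_ne_of_ne z1 z2]
  exact h.2.2 w c hw

/-- Sufficient condition for the agent at `v` not wanting to jump to `w`. -/
def Ok {V T : Type*} (G : SimpleGraph V) (g : V → Option T) (v w : V) (c : T) : Prop :=
  (∀ z d, G.Adj w z → z ≠ v → g z = some d → d = c) ∨
  ((∃ z d, G.Adj v z ∧ g z = some d ∧ d ≠ c) ∧
    ∃ e, ∀ z d, G.Adj w z → z ≠ v → g z = some d → d = c ∨ d = e) ∨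
  ((∃ z d z' d', G.Adj v z ∧ g z = some d ∧ d ≠ c ∧ G.Adj v z' ∧ g z' = some d' ∧ d' ≠ c ∧ d ≠ d') ∧
    ∃ e f, ∀ z d, G.Adj w z → z ≠ v → g z = some d → d = c ∨ d = e ∨ d = f)

lemma Ok.le {V T : Type*} [Finite T] {G : SimpleGraph V} {g : V → Option T} {v w : V} {c : T}
    (h : Ok G g v w c) : (seen G g v w c).ncard ≤ (seen G g v v c).ncard := by
  rcases h with h | ⟨⟨z, d, h1, h2, h3⟩, e, h⟩ | ⟨⟨z, d, z', d', h1, h2, h3, h4, h5, h6, h7⟩, e, f, h⟩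
  · have : seen G g v w c = ∅ := by
      ext d
      simp only [seen, Set.mem_ofPred_eq, Set.mem_empty_iff_false, iff_false]
      rintro ⟨k1, z, k2, k3, k4⟩
      exact k1 (h z d k2 k3 k4)
    simp [this]
  · calc (seen G g v w c).ncard ≤ ({e} : Set T).ncard := by
          apply Set.ncard_le_ncard _ (Set.toFinite _)
          rintro d ⟨k1, z, k2, k3, k4⟩
          simpa [k1] using h z d k2 k3 k4
      _ = ({d} : Set T).ncard := by simp
      _ ≤ _ := by
          apply Set.ncard_le_ncard _ (Set.toFinite _)
          rintro _ rfl
          exact ⟨h3, z, h1, h1.ne', h2⟩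
  · calc (seen G g v w c).ncard ≤ ({e, f} : Set T).ncard := by
          apply Set.ncard_le_ncard _ (Set.toFinite _)
          rintro d ⟨k1, z, k2, k3, k4⟩
          simpa [k1] using h z d k2 k3 k4
      _ ≤ 2 := by
          have := Set.ncard_insert_le e {f}
          simpa using this
      _ = ({d, d'} : Set T).ncard := by rw [Set.ncard_pair h7]
      _ ≤ _ := by
          apply Set.ncard_le_ncard _ (Set.toFinite _)
          rintro x (rfl | rfl)
          · exact ⟨h3, z, h1, h1.ne', h2⟩
          · exact ⟨h6, z', h4, h4.ne', h5⟩

lemma equil_ok {V A T : Type*} [Finite T] {G : SimpleGraph V} {t : A → T} {g : V → Option T}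
    (hg : Cfg t g)
    (H : ∀ v w c, g v = some c → g w = none → Ok G g v w c) :
    ∃ σ : A ↪ V, IsEquilibrium G t σ :=
  equil_of hg fun v w c h1 h2 => (H v w c h1 h2).le

/-- every empty node sees at most one type, and agents with utility `0` are of the type
of all the frontier agents. -/
lemma equil_star {V A T : Type*} [Finite T] {G : SimpleGraph V} {t : A → T} {g : V → Option T}
    (hg : Cfg t g)
    (H1 : ∀ w z z' d d', g w = none → G.Adj w z → G.Adj w z' → g z = some d → g z' = some d' →
      d = d')
    (H2 : ∀ v c, g v = some c → (∃ z d, G.Adj v z ∧ g z = some d ∧ d ≠ c) ∨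
      ∀ w z d, g w = none → G.Adj w z → g z = some d → d = c) :
    ∃ σ : A ↪ V, IsEquilibrium G t σ := by
  apply equil_ok hg
  intro v w c hv hw
  rcases H2 v c hv with h | h
  · right; left
    refine ⟨h, ?_⟩
    by_cases hz : ∃ z d, G.Adj w z ∧ g z = some d
    · obtain ⟨z, d, k1, k2⟩ := hz
      exact ⟨d, fun z' d' k3 _ k4 => Or.inr (H1 w z' z d' d hw k3 k1 k4 k2)⟩
    · exact ⟨c, fun z' d' k3 _ k4 => absurd ⟨z', d', k3, k4⟩ hz⟩
  · left
    intro z d k1 _ k2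
    exact h w z d hw k1 k2

lemma exists_min' {X : Type*} (P : X → Prop) (h : ∃ x, P x) (f : X → ℕ) :
    ∃ x, P x ∧ ∀ y, P y → f x ≤ f y := by
  obtain ⟨x, hx, hm⟩ := (measure f).wf.has_min {x | P x} h
  exact ⟨x, hx, fun y hy => not_lt.1 (hm y hy)⟩

/-- one empty node: potential argument -/
lemma equil_one {V A T : Type*} [Fintype A] [Fintype V] [Finite T] (G : SimpleGraph V)
    (t : A → T) (hc : Fintype.card V = Fintype.card A + 1) :
    ∃ σ : A ↪ V, IsEquilibrium G t σ := by
  classical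
  let tau : (V → Option T) × V → ℕ := fun p => {d | ∃ z, G.Adj p.2 z ∧ p.1 z = some d}.ncard
  let mono : (V → Option T) × V → ℕ := fun p =>
    {e : V × V | G.Adj e.1 e.2 ∧ p.1 e.1 ≠ none ∧ p.1 e.1 = p.1 e.2}.ncard
  let P : (V → Option T) × V → Prop := fun p => Cfg t p.1 ∧ ∀ v, p.1 v = none ↔ v = p.2
  have h0 : ∃ p, P p := by
    have : Nonempty V := Fintype.card_pos_iff.1 (by omega)
    obtain ⟨w⟩ := this
    obtain ⟨g, hg, hR⟩ := exists_cfg t (Finset.univ.erase w) (by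
      rw [Finset.card_erase_of_mem (Finset.mem_univ _), Finset.card_univ]; omega)
    refine ⟨(g, w), hg, fun v => ?_⟩
    have := hR v
    simp at this
    tauto
  obtain ⟨p1, hp1, hm1⟩ := exists_min' P h0 tau
  obtain ⟨⟨g, w⟩, ⟨⟨hg, hgw⟩, hmt⟩, hmm⟩ := exists_min' (fun p => P p ∧ tau p = tau p1)
    ⟨p1, hp1, rfl⟩ mono
  change Cfg t g at hg
  change ∀ v, g v = none ↔ v = w at hgw
  apply equil_of hg
  intro v w' c hv hw'
  have hww := (hgw w').1 hw'
  subst hww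
  by_contra hlt
  push Not at hlt
  have hvw : v ≠ w' := by rintro rfl; simp [hv] at hw'
  set g' : V → Option T := g ∘ Equiv.swap v w' with hg'
  have e1 : g' w' = some c := by simp [hg', hv]
  have e2 : g' v = none := by simp [hg', hw']
  have e3 : ∀ z, z ≠ v → z ≠ w' → g' z = g z := by
    intro z h1 h2
    simp [hg', Equiv.swap_apply_of_ne_of_ne h1 h2]
  have hP' : P (g', v) := by
    refine ⟨hg.perm _, fun z => ?_⟩
    simp only
    by_cases h1 : z = v
    · subst h1; simp [e2]
    by_cases h2 : z = w'
    · subst h2; simp [e1, h1]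
    rw [e3 z h1 h2]
    have := hgw z
    tauto
  have a1 : tau (g', v) ≤ (seen G g v v c).ncard + 1 := by
    have : {d | ∃ z, G.Adj v z ∧ g' z = some d} ⊆ insert c (seen G g v v c) := by
      rintro d ⟨z, h1, h2⟩
      by_cases hz : z = w'
      · subst hz; rw [e1] at h2; left; exact (Option.some.inj h2).symm
      · rw [e3 z h1.ne' hz] at h2
        by_cases hd : d = c
        · left; exact hd
        · right; exact ⟨hd, z, h1, h1.ne', h2⟩
    exact (Set.ncard_le_ncard this (Set.toFinite _)).trans (Set.ncard_insert_le _ _)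
  have sub2 : seen G g v w' c ⊆ {d | ∃ z, G.Adj w' z ∧ g z = some d} := by
    rintro d ⟨_, z, h1, _, h2⟩
    exact ⟨z, h1, h2⟩
  have a2 : (seen G g v w' c).ncard ≤ tau (g, w') :=
    Set.ncard_le_ncard sub2 (Set.toFinite _)
  have a3 : tau (g, w') ≤ tau (g', v) := by rw [hmt]; exact hm1 _ hP'
  have b1 : ∀ z, G.Adj w' z → g z ≠ some c := by
    intro z h1 h2
    have : insert c (seen G g v w' c) ⊆ {d | ∃ z, G.Adj w' z ∧ g z = some d} := by
      intro d hd
      rcases hd with rfl | hd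
      · exact ⟨z, h1, h2⟩
      · exact sub2 hd
    have := Set.ncard_le_ncard this (Set.toFinite _)
    rw [Set.ncard_insert_of_notMem (fun h => h.1 rfl)] at this
    have : (seen G g v w' c).ncard + 1 ≤ tau (g, w') := this
    omega
  have hnadj : ¬ G.Adj w' v := fun h => b1 v h hv
  have b2 : ∃ z, G.Adj v z ∧ g z = some c := by
    by_contra hcon
    push Not at hcon
    have : {d | ∃ z, G.Adj v z ∧ g' z = some d} ⊆ seen G g v v c := by
      rintro d ⟨z, h1, h2⟩
      have hz : z ≠ w' := by rintro rfl; exact hnadj h1.symm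
      rw [e3 z h1.ne' hz] at h2
      refine ⟨?_, z, h1, h1.ne', h2⟩
      rintro rfl
      exact hcon z h1 h2
    have : tau (g', v) ≤ _ := Set.ncard_le_ncard this (Set.toFinite _)
    omega
  have hle := hmm (g', v) ⟨hP', by omega⟩
  refine absurd hle (not_le.2 (Set.ncard_lt_ncard ?_ (Set.toFinite _)))
  rw [Set.ssubset_iff_of_subset]
  · obtain ⟨z, h1, h2⟩ := b2
    refine ⟨(v, z), ⟨h1, by simp [hv], by simp [hv, h2]⟩, ?_⟩
    rintro ⟨_, h, _⟩
    exact h e2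
  · rintro ⟨x, y⟩ ⟨h1, h2, h3⟩
    simp only at h1 h2 h3
    have hx : x ≠ v := by rintro rfl; exact h2 e2
    have hy : y ≠ v := by rintro rfl; rw [h3] at h2; exact h2 e2
    have hx' : x ≠ w' := by
      rintro rfl
      rw [e1, e3 y hy h1.ne'] at h3
      exact b1 y h1 h3.symm
    have hy' : y ≠ w' := by
      rintro rfl
      rw [e1, e3 x hx hx'] at h3
      exact b1 x h1.symm h3
    rw [e3 x hx hx', e3 y hy hy'] at h3
    rw [e3 x hx hx'] at h2
    exact ⟨h1, h2, h3⟩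

/-- all types distinct: maximize the number of occupied edges -/
lemma equil_inj {V A T : Type*} [Fintype A] [Fintype V] [Finite T] (G : SimpleGraph V)
    (t : A → T) (ht : Function.Injective t) (hc : Fintype.card A ≤ Fintype.card V) :
    ∃ σ : A ↪ V, IsEquilibrium G t σ := by
  classical
  let S : (V → Option T) → Set (V × V) := fun g =>
    {e | G.Adj e.1 e.2 ∧ g e.1 ≠ none ∧ g e.2 ≠ none}
  obtain ⟨g, hg, hmax⟩ := exists_max (fun g : V → Option T => Cfg t g) (by
    obtain ⟨R, -, hR⟩ := Finset.exists_subset_card_eq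
      (s := (Finset.univ : Finset V)) (n := Fintype.card A) (by simpa using hc)
    obtain ⟨g, hg, -⟩ := exists_cfg t R hR
    exact ⟨g, hg⟩) (fun g => (S g).ncard)
  have hinj : ∀ x y d, g x = some d → g y = some d → x = y := by
    obtain ⟨σ, h1, h2⟩ := hg
    intro x y d hx hy
    obtain ⟨i, rfl⟩ := h2 x (by simp [hx])
    obtain ⟨j, rfl⟩ := h2 y (by simp [hy])
    rw [h1] at hx hy
    rw [← hy] at hx
    rw [ht (Option.some.inj hx)]
  apply equil_of hg
  intro v w c hv hw
  by_contra hlt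
  push Not at hlt
  let N : V → Set V := fun x => {z | G.Adj x z ∧ z ≠ v ∧ g z ≠ none}
  have hN : ∀ x, (seen G g v x c).ncard = (N x).ncard := by
    intro x
    rw [← Set.ncard_image_of_injective (seen G g v x c) (Option.some_injective T),
      ← Set.InjOn.ncard_image (s := N x) (f := g)]
    · congr 1
      ext o
      constructor
      · rintro ⟨d, ⟨_, z, h1, h2, h3⟩, rfl⟩
        exact ⟨z, ⟨h1, h2, by simp [h3]⟩, h3⟩
      · rintro ⟨z, ⟨h1, h2, h3⟩, rfl⟩
        obtain ⟨d, hd⟩ := Option.ne_none_iff_exists'.1 h3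
        refine ⟨d, ⟨?_, z, h1, h2, hd⟩, hd.symm⟩
        rintro rfl
        exact h2 (hinj _ _ _ hd hv)
    · intro x hx y hy hxy
      obtain ⟨d, hd⟩ := Option.ne_none_iff_exists'.1 hx.2.2
      exact hinj x y d hd (by rw [← hxy, hd])
  rw [hN, hN] at hlt
  have hvw : v ≠ w := by rintro rfl; simp [hv] at hw
  have hm := hmax _ (hg.perm (Equiv.swap v w))
  set g' : V → Option T := g ∘ Equiv.swap v w with hg'
  have e1 : g' w = some c := by simp [hg', hv]
  have e3 : ∀ z, z ≠ v → z ≠ w → g' z = g z := by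
    intro z h1 h2
    simp [hg', Equiv.swap_apply_of_ne_of_ne h1 h2]
  let K : Set (V × V) := {e | G.Adj e.1 e.2 ∧ g e.1 ≠ none ∧ g e.2 ≠ none ∧ e.1 ≠ v ∧ e.2 ≠ v}
  have c1 : ∀ x, (Prod.mk x '' N x).ncard = (N x).ncard := fun x =>
    Set.ncard_image_of_injective _ (Prod.mk_right_injective x)
  have c2 : ∀ x, ((fun z => (z, x)) '' N x).ncard = (N x).ncard := fun x =>
    Set.ncard_image_of_injective _ (Prod.mk_left_injective x)
  have l1 : (S g).ncard ≤ K.ncard + (N v).ncard + (N v).ncard := by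
    have : S g ⊆ K ∪ (Prod.mk v '' N v) ∪ ((fun z => (z, v)) '' N v) := by
      rintro ⟨x, y⟩ ⟨h1, h2, h3⟩
      simp only at h1 h2 h3
      by_cases hx : x = v
      · subst hx
        left; right; exact ⟨y, ⟨h1, h1.ne', h3⟩, rfl⟩
      by_cases hy : y = v
      · subst hy
        right; exact ⟨x, ⟨h1.symm, h1.ne, h2⟩, rfl⟩
      left; left; exact ⟨h1, h2, h3, hx, hy⟩
    have k1 := Set.ncard_le_ncard this (Set.toFinite _)
    have k2 := Set.ncard_union_le (K ∪ (Prod.mk v '' N v)) ((fun z => (z, v)) '' N v)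
    have k3 := Set.ncard_union_le K (Prod.mk v '' N v)
    rw [c2] at k2
    rw [c1] at k3
    omega
  have l2 : K.ncard + (N w).ncard + (N w).ncard ≤ (S g').ncard := by
    have hKw : ∀ e ∈ K, e.1 ≠ w ∧ e.2 ≠ w := by
      rintro ⟨x, y⟩ ⟨h1, h2, h3, h4, h5⟩
      constructor <;> rintro rfl
      · exact h2 hw
      · exact h3 hw
    have d1 : Disjoint K (Prod.mk w '' N w) := by
      rw [Set.disjoint_left]
      rintro e he ⟨z', hz', he'⟩
      exact (hKw e he).1 (by rw [← he'])
    have d2 : Disjoint (K ∪ (Prod.mk w '' N w)) ((fun z => (z, w)) '' N w) := by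
      rw [Set.disjoint_left]
      rintro e (he | ⟨z, hz, rfl⟩) ⟨z', hz', he'⟩
      · exact (hKw e he).2 (by rw [← he'])
      · have : z = w := by simpa using (congrArg Prod.snd he').symm
        exact hz.1.ne' this
    have k1 := Set.ncard_union_eq d1 (Set.toFinite _) (Set.toFinite _)
    have k2 := Set.ncard_union_eq d2 (Set.toFinite _) (Set.toFinite _)
    rw [c1] at k1
    rw [c2] at k2
    rw [← k1, ← k2]
    · apply Set.ncard_le_ncard _ (Set.toFinite _)
      rintro e ((he | ⟨z, ⟨h1, h2, h3⟩, rfl⟩) | ⟨z, ⟨h1, h2, h3⟩, rfl⟩)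
      · have := hKw e he
        obtain ⟨h1, h2, h3, h4, h5⟩ := he
        refine ⟨h1, ?_, ?_⟩
        · rw [e3 _ h4 this.1]; exact h2
        · rw [e3 _ h5 this.2]; exact h3
      · exact ⟨h1, by simp [e1], by simp only; rw [e3 z h2 h1.ne']; exact h3⟩
      · exact ⟨h1.symm, by simp only; rw [e3 z h2 h1.ne']; exact h3, by simp [e1]⟩
  have : (S g').ncard ≤ (S g).ncard := hm
  omega

/-- column of a node -/
def xc {m : ℕ} (v : ZMod m × Fin 2) : ℕ := v.1.val
/-- row of a node -/
def yc {m : ℕ} (v : ZMod m × Fin 2) : ℕ := v.2.val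
/-- node with given coordinates -/
def nd (m a b : ℕ) : ZMod m × Fin 2 := ((a : ZMod m), Fin.ofNat 2 b)

lemma xc_nd {m a b : ℕ} (h : a < m) : xc (nd m a b) = a := by
  simp [xc, nd, ZMod.val_natCast, Nat.mod_eq_of_lt h]

lemma yc_nd {m a b : ℕ} (h : b < 2) : yc (nd m a b) = b := by
  simp [yc, nd, Nat.mod_eq_of_lt h]

lemma xc_lt {m : ℕ} [NeZero m] (v : ZMod m × Fin 2) : xc v < m := ZMod.val_lt _
lemma yc_lt {m : ℕ} (v : ZMod m × Fin 2) : yc v < 2 := v.2.isLt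

lemma nd_ext {m : ℕ} [NeZero m] {u v : ZMod m × Fin 2} (h1 : xc u = xc v) (h2 : yc u = yc v) :
    u = v :=
  Prod.ext (ZMod.val_injective m h1) (Fin.ext h2)

lemma nd_eta {m : ℕ} [NeZero m] (v : ZMod m × Fin 2) : nd m (xc v) (yc v) = v :=
  nd_ext (xc_nd (xc_lt v)) (yc_nd (yc_lt v))

lemma nd_eq {m : ℕ} [NeZero m] (v : ZMod m × Fin 2) {a b : ℕ} (h1 : xc v = a) (h2 : yc v = b) :
    v = nd m a b := by
  subst h1; subst h2; exact (nd_eta v).symm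

lemma cyl_adj {m : ℕ} [NeZero m] (hm : 3 ≤ m) (u v : ZMod m × Fin 2) :
    (cylinderGraph m).Adj u v ↔
      (yc u = yc v ∧ (xc u + 1 = xc v ∨ xc v + 1 = xc u ∨ (xc u = 0 ∧ xc v + 1 = m) ∨
        (xc v = 0 ∧ xc u + 1 = m))) ∨ (xc u = xc v ∧ yc u ≠ yc v) := by
  have key : ∀ a b : ZMod m, a = b + 1 ↔ (a.val = b.val + 1 ∨ (a.val = 0 ∧ b.val + 1 = m)) := by
    intro a b
    rw [← (ZMod.val_injective m).eq_iff, ZMod.val_add, ZMod.val_one_eq_one_mod,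
      Nat.mod_eq_of_lt (by omega : 1 < m)]
    have ha := ZMod.val_lt a
    have hb := ZMod.val_lt b
    by_cases h : b.val + 1 = m
    · rw [h, Nat.mod_self]; omega
    · rw [Nat.mod_eq_of_lt (by omega)]; omega
  have hy : ∀ a b : Fin 2, a = b ↔ a.val = b.val := fun a b => Fin.ext_iff
  have hx : ∀ a b : ZMod m, a = b ↔ a.val = b.val := fun a b => (ZMod.val_injective m).eq_iff.symm
  obtain ⟨a, b⟩ := u
  obtain ⟨c, d⟩ := v
  simp only [cylinderGraph, SimpleGraph.fromRel_adj, key, xc, yc, ne_eq, Prod.mk.injEq]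
  rw [hy b d, hy d b, hx a c, hx c a]
  omega

/-- set of nodes with coordinates in `S` -/
def ns (m : ℕ) [NeZero m] (S : Finset (ℕ × ℕ)) : Finset (ZMod m × Fin 2) :=
  Finset.univ.filter (fun v => (xc v, yc v) ∈ S)

lemma mem_ns {m : ℕ} [NeZero m] {S : Finset (ℕ × ℕ)} {v : ZMod m × Fin 2} :
    v ∈ ns m S ↔ (xc v, yc v) ∈ S := by simp [ns]

lemma card_ns {m : ℕ} [NeZero m] (S : Finset (ℕ × ℕ)) (hS : ∀ q ∈ S, q.1 < m ∧ q.2 < 2) :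
    (ns m S).card = S.card := by
  apply Finset.card_bij (fun v _ => (xc v, yc v))
  · intro v hv; exact mem_ns.1 hv
  · intro u _ v _ h
    exact nd_ext (congrArg Prod.fst h) (congrArg Prod.snd h)
  · rintro ⟨a, b⟩ h
    have := hS _ h
    refine ⟨nd m a b, ?_, ?_⟩
    · rw [mem_ns, xc_nd this.1, yc_nd this.2]; exact h
    · rw [xc_nd this.1, yc_nd this.2]

/-- A configuration with occupied coordinates `S`, type `a` on `F1` and `b` on `F2`. -/
def Conf {A T : Type*} (m : ℕ) (t : A → T) (S F1 F2 : Finset (ℕ × ℕ)) (a b : T)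
    (g : ZMod m × Fin 2 → Option T) : Prop :=
  Cfg t g ∧ (∀ v, g v ≠ none ↔ (xc v, yc v) ∈ S) ∧ (∀ v, (xc v, yc v) ∈ F1 → g v = some a) ∧
    (∀ v, (xc v, yc v) ∈ F2 → g v = some b)

lemma exists_conf {A T : Type*} [Fintype A] [Finite T] {m : ℕ} [NeZero m] (t : A → T)
    (S F1 F2 : Finset (ℕ × ℕ)) (a b : T)
    (hS : ∀ q ∈ S, q.1 < m ∧ q.2 < 2) (hc : S.card = Fintype.card A)
    (h1 : F1 ⊆ S) (h2 : F2 ⊆ S) (hd : Disjoint F1 F2) (hab : a ≠ b)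
    (c1 : F1.card ≤ cnt t a) (c2 : F2.card ≤ cnt t b) :
    ∃ g, Conf m t S F1 F2 a b g := by
  classical
  let φ : ZMod m × Fin 2 → Option T := fun v =>
    if (xc v, yc v) ∈ F1 then some a else if (xc v, yc v) ∈ F2 then some b else none
  obtain ⟨g, hg, hR, hφ⟩ := exists_dem t (ns m S) (by rw [card_ns S hS, hc]) φ (by
      intro v hv
      rw [mem_ns]
      by_cases k1 : (xc v, yc v) ∈ F1
      · exact h1 k1
      by_cases k2 : (xc v, yc v) ∈ F2
      · exact h2 k2
      simp [φ, k1, k2] at hv) (by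
      intro c
      by_cases k1 : c = a
      · subst k1
        calc _ ≤ (ns m F1).card := by
              apply Finset.card_le_card
              intro v hv
              rw [mem_ns]
              by_contra k
              by_cases k2 : (xc v, yc v) ∈ F2 <;> simp [φ, k, k2] at hv
              exact hab hv.symm
          _ = F1.card := card_ns _ fun q hq => hS q (h1 hq)
          _ ≤ _ := c1
      by_cases k2 : c = b
      · subst k2
        calc _ ≤ (ns m F2).card := by
              apply Finset.card_le_card
              intro v hv
              rw [mem_ns]
              by_contra k
              by_cases k2 : (xc v, yc v) ∈ F1 <;> simp [φ, k, k2] at hv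
              exact hab hv
          _ = F2.card := card_ns _ fun q hq => hS q (h2 hq)
          _ ≤ _ := c2
      · rw [Finset.card_eq_zero.2]
        · exact Nat.zero_le _
        · rw [Finset.filter_eq_empty_iff]
          intro v _
          simp only [φ]
          split_ifs
          · intro h; exact k1 (Option.some.inj h).symm
          · intro h; exact k2 (Option.some.inj h).symm
          · simp)
  refine ⟨g, hg, fun v => by rw [hR, mem_ns], ?_, ?_⟩
  · intro v hv
    apply hφ
    simp [φ, hv]
  · intro v hv
    apply hφ
    have : (xc v, yc v) ∉ F1 := fun h => Finset.disjoint_left.1 hd h hv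
    simp [φ, hv, this]

lemma Conf.swap {A T : Type*} {m : ℕ} [NeZero m] {t : A → T} {S F1 F2 : Finset (ℕ × ℕ)} {a b : T}
    {g : ZMod m × Fin 2 → Option T} (h : Conf m t S F1 F2 a b g) {u v : ZMod m × Fin 2}
    (hu : (xc u, yc u) ∈ S) (hv : (xc v, yc v) ∈ S)
    (hu' : (xc u, yc u) ∉ F1 ∪ F2) (hv' : (xc v, yc v) ∉ F1 ∪ F2) :
    Conf m t S F1 F2 a b (g ∘ Equiv.swap u v) := by
  have hne : ∀ w, (xc w, yc w) ∈ F1 ∪ F2 → (g ∘ Equiv.swap u v) w = g w := by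
    intro w hw
    have z1 : w ≠ u := by rintro rfl; exact hu' hw
    have z2 : w ≠ v := by rintro rfl; exact hv' hw
    simp [Equiv.swap_apply_of_ne_of_ne z1 z2]
  refine ⟨h.1.perm _, ?_, ?_, ?_⟩
  · have := occ_swap (R := ns m S) (g := g) (by intro v; rw [mem_ns]; exact h.2.1 v)
      (mem_ns.2 hu) (mem_ns.2 hv)
    intro w
    rw [this w, mem_ns]
  · intro w hw
    rw [hne w (Finset.mem_union_left _ hw)]; exact h.2.2.1 w hw
  · intro w hw
    rw [hne w (Finset.mem_union_right _ hw)]; exact h.2.2.2 w hw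

/-- Extremal pairing lemma: if a column in the range is monochromatic of type `C`
then every column in the range contains `C`. -/
lemma exists_cols {A T : Type*} [Fintype A] [Finite T] {m : ℕ} [NeZero m] (t : A → T)
    (S F1 F2 : Finset (ℕ × ℕ)) (a b : T)
    (hS : ∀ q ∈ S, q.1 < m ∧ q.2 < 2) (hc : S.card = Fintype.card A)
    (h1 : F1 ⊆ S) (h2 : F2 ⊆ S) (hd : Disjoint F1 F2) (hab : a ≠ b)
    (c1 : F1.card ≤ cnt t a) (c2 : F2.card ≤ cnt t b) (lo hi : ℕ)
    (hK : ∀ x, lo ≤ x → x ≤ hi → (x, 0) ∈ S ∧ (x, 1) ∈ S ∧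
      ∃ y, y < 2 ∧ (x, y) ∉ F1 ∪ F2) :
    ∃ g, Conf m t S F1 F2 a b g ∧ ∀ x C, lo ≤ x → x ≤ hi → g (nd m x 0) = some C →
      g (nd m x 1) = some C → ∀ x', lo ≤ x' → x' ≤ hi →
        g (nd m x' 0) = some C ∨ g (nd m x' 1) = some C := by
  classical
  obtain ⟨g, hg, hmax⟩ := exists_max _
    (exists_conf (m := m) t S F1 F2 a b hS hc h1 h2 hd hab c1 c2)
    (fun g => ((Finset.Icc lo hi).filter (fun x => g (nd m x 0) ≠ g (nd m x 1))).card)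
  refine ⟨g, hg, ?_⟩
  intro x C hx1 hx2 hx0 hx1' x' hx1'' hx2'
  by_contra hcon
  push Not at hcon
  have hxx : x ≠ x' := by rintro rfl; exact hcon.1 hx0
  obtain ⟨s0, s1, y, hy, hyF⟩ := hK x hx1 hx2
  obtain ⟨s0', s1', y', hy', hyF'⟩ := hK x' hx1'' hx2'
  have hxm := (hS _ s0).1
  have hxm' := (hS _ s0').1
  simp only at hxm hxm'
  have hmS : ∀ z, z < 2 → (x, z) ∈ S ∧ (x', z) ∈ S ∧ g (nd m x z) = some C ∧
      g (nd m x' z) ≠ some C := by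
    intro z hz
    interval_cases z
    · exact ⟨s0, s0', hx0, hcon.1⟩
    · exact ⟨s1, s1', hx1', hcon.2⟩
  have hm := hmax _ (hg.swap (u := nd m x y) (v := nd m x' y')
    (by rw [xc_nd hxm, yc_nd hy]; exact (hmS y hy).1)
    (by rw [xc_nd hxm', yc_nd hy']; exact (hmS y' hy').2.1)
    (by rw [xc_nd hxm, yc_nd hy]; exact hyF)
    (by rw [xc_nd hxm', yc_nd hy']; exact hyF'))
  set g' := g ∘ Equiv.swap (nd m x y) (nd m x' y') with hg'
  have e1 : g' (nd m x y) = g (nd m x' y') := by simp [hg']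
  have e2 : g' (nd m x' y') = some C := by simp [hg', (hmS y hy).2.2.1]
  have e3 : ∀ z w, z < m → w < 2 → (z ≠ x ∨ w ≠ y) → (z ≠ x' ∨ w ≠ y') →
      g' (nd m z w) = g (nd m z w) := by
    intro z w hz hw k1 k2
    have z1 : nd m z w ≠ nd m x y := by
      intro h
      have a1 := congrArg xc h
      have a2 := congrArg yc h
      rw [xc_nd hz, xc_nd hxm] at a1
      rw [yc_nd hw, yc_nd hy] at a2
      omega
    have z2 : nd m z w ≠ nd m x' y' := by
      intro h
      have a1 := congrArg xc h
      have a2 := congrArg yc h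
      rw [xc_nd hz, xc_nd hxm'] at a1
      rw [yc_nd hw, yc_nd hy'] at a2
      omega
    simp [hg', Equiv.swap_apply_of_ne_of_ne z1 z2]
  have f1 : g' (nd m x 0) ≠ g' (nd m x 1) := by
    have q := (hmS y' hy').2.2.2
    have : y = 0 ∨ y = 1 := by omega
    rcases this with rfl | rfl
    · rw [e1, e3 x 1 hxm (by omega) (by omega) (by omega), hx1']; exact q
    · rw [e1, e3 x 0 hxm (by omega) (by omega) (by omega), hx0]; exact q.symm
  have f2 : g' (nd m x' 0) ≠ g' (nd m x' 1) := by
    have : y' = 0 ∨ y' = 1 := by omega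
    rcases this with rfl | rfl
    · rw [e2, e3 x' 1 hxm' (by omega) (by omega) (by omega)]; exact hcon.2.symm
    · rw [e2, e3 x' 0 hxm' (by omega) (by omega) (by omega)]; exact hcon.1
  refine absurd hm (not_le.2 (Finset.card_lt_card ?_))
  rw [Finset.ssubset_iff_of_subset]
  · refine ⟨x, ?_, ?_⟩
    · simp only [Finset.mem_filter, Finset.mem_Icc]
      exact ⟨⟨hx1, hx2⟩, f1⟩
    · simp [hx0, hx1']
  · intro z hz
    simp only [Finset.mem_filter, Finset.mem_Icc] at hz ⊢
    refine ⟨hz.1, ?_⟩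
    by_cases k1 : z = x
    · subst k1; exact f1
    by_cases k2 : z = x'
    · subst k2; exact f2
    have hzm := (hS _ (hK z hz.1.1 hz.1.2).1).1
    rw [e3 z 0 hzm (by omega) (by omega) (by omega), e3 z 1 hzm (by omega) (by omega) (by omega)]
    exact hz.2

lemma Cfg.le_cnt' {A T : Type*} [Fintype A] {m : ℕ} [NeZero m] {t : A → T}
    {g : ZMod m × Fin 2 → Option T} (hg : Cfg t g) (C : T) (E : Finset (ℕ × ℕ))
    (hE : ∀ q ∈ E, q.1 < m ∧ q.2 < 2 ∧ g (nd m q.1 q.2) = some C) : E.card ≤ cnt t C := by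
  rw [← card_ns (m := m) E (fun q hq => ⟨(hE q hq).1, (hE q hq).2.1⟩)]
  apply hg.le_cnt
  intro v hv
  have := (hE _ (mem_ns.1 hv)).2.2
  rwa [nd_eta] at this

lemma count_cols {A T : Type*} [Fintype A] {m : ℕ} [NeZero m] {t : A → T}
    {g : ZMod m × Fin 2 → Option T} (hg : Cfg t g) (C : T) (lo hi x : ℕ) (hhi : hi < m)
    (h : ∀ x', lo ≤ x' → x' ≤ hi → g (nd m x' 0) = some C ∨ g (nd m x' 1) = some C)
    (h1 : lo ≤ x) (h2 : x ≤ hi) (h3 : g (nd m x 0) = some C) (h4 : g (nd m x 1) = some C)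
    (E : Finset (ℕ × ℕ))
    (hE : ∀ q ∈ E, q.1 < m ∧ q.2 < 2 ∧ g (nd m q.1 q.2) = some C ∧ (q.1 < lo ∨ hi < q.1)) :
    (hi + 1 - lo) + 1 + E.card ≤ cnt t C := by
  classical
  have : ∀ x', ∃ y, y < 2 ∧ (lo ≤ x' → x' ≤ hi → g (nd m x' y) = some C) := by
    intro x'
    by_cases k : lo ≤ x' ∧ x' ≤ hi
    · rcases h x' k.1 k.2 with h | h
      · exact ⟨0, by omega, fun _ _ => h⟩
      · exact ⟨1, by omega, fun _ _ => h⟩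
    · exact ⟨0, by omega, fun a b => absurd ⟨a, b⟩ k⟩
  choose y hy hyC using this
  set D := (Finset.Icc lo hi).image (fun a => (a, y a)) with hD
  have cD : D.card = hi + 1 - lo := by
    rw [hD, Finset.card_image_of_injective _ (fun a b h => congrArg Prod.fst h)]
    simp
  have n1 : (x, 1 - y x) ∉ D := by
    simp only [hD, Finset.mem_image, Prod.mk.injEq, not_exists, not_and]
    rintro z _ rfl
    have := hy z
    omega
  have dj : Disjoint (insert (x, 1 - y x) D) E := by
    rw [Finset.disjoint_left]
    intro q hq hqE
    have := (hE q hqE).2.2.2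
    rw [Finset.mem_insert] at hq
    rcases hq with rfl | hq
    · simp only at this; omega
    · rw [hD, Finset.mem_image] at hq
      obtain ⟨z, hz, rfl⟩ := hq
      rw [Finset.mem_Icc] at hz
      simp only at this
      omega
  have := hg.le_cnt' C (insert (x, 1 - y x) D ∪ E) (by
    intro q hq
    rw [Finset.mem_union, Finset.mem_insert] at hq
    rcases hq with (rfl | hq) | hq
    · refine ⟨by simp only; omega, by simp only; omega, ?_⟩
      simp only
      have : 1 - y x = 0 ∨ 1 - y x = 1 := by omega
      rcases this with e | e <;> rw [e] <;> assumption
    · rw [hD, Finset.mem_image] at hq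
      obtain ⟨z, hz, rfl⟩ := hq
      rw [Finset.mem_Icc] at hz
      exact ⟨by simp only; omega, hy z, hyC z hz.1 hz.2⟩
    · exact ⟨(hE q hq).1, (hE q hq).2.1, (hE q hq).2.2.1⟩)
  rw [Finset.card_union_of_disjoint dj, Finset.card_insert_of_notMem n1, cD] at this
  exact this

lemma cnt_add {A T : Type*} [Fintype A] (t : A → T) {a b : T} (h : a ≠ b) :
    cnt t a + cnt t b ≤ Fintype.card A := by
  classical
  unfold cnt
  rw [← Finset.card_union_of_disjoint]
  · exact Finset.card_le_univ _
  · rw [Finset.disjoint_left]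
    intro i h1 h2
    simp at h1 h2
    exact h (h1.symm.trans h2)

lemma cnt_add3 {A T : Type*} [Fintype A] (t : A → T) {a b c : T} (h : a ≠ b) (h' : a ≠ c)
    (h'' : b ≠ c) : cnt t a + cnt t b + cnt t c ≤ Fintype.card A := by
  classical
  unfold cnt
  rw [← Finset.card_union_of_disjoint, ← Finset.card_union_of_disjoint]
  · exact Finset.card_le_univ _
  · rw [Finset.disjoint_left]
    intro i h1 h2
    simp at h1 h2
    rcases h1 with h1 | h1
    · exact h' (h1.symm.trans h2)
    · exact h'' (h1.symm.trans h2)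
  · rw [Finset.disjoint_left]
    intro i h1 h2
    simp at h1 h2
    exact h (h1.symm.trans h2)

lemma cnt_pos {A T : Type*} [Fintype A] {t : A → T} (ht : Function.Surjective t) (c : T) :
    1 ≤ cnt t c := by
  classical
  obtain ⟨i, hi⟩ := ht c
  exact Finset.card_pos.2 ⟨i, by simpa using hi⟩

/-- adjacency in coordinates -/
def ad (m x y x' y' : ℕ) : Prop :=
  (y = y' ∧ (x + 1 = x' ∨ x' + 1 = x ∨ (x = 0 ∧ x' + 1 = m) ∨ (x' = 0 ∧ x + 1 = m))) ∨
    (x = x' ∧ y ≠ y')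

lemma cyl_ad {m : ℕ} [NeZero m] (hm : 3 ≤ m) {u v : ZMod m × Fin 2} :
    (cylinderGraph m).Adj u v ↔ ad m (xc u) (yc u) (xc v) (yc v) := cyl_adj hm u v

lemma cyl_ad' {m : ℕ} [NeZero m] (hm : 3 ≤ m) {u : ZMod m × Fin 2} {x y : ℕ} (hx : x < m)
    (hy : y < 2) (h : ad m (xc u) (yc u) x y) : (cylinderGraph m).Adj u (nd m x y) := by
  rw [cyl_ad hm, xc_nd hx, yc_nd hy]; exact h

lemma Conf.at1 {A T : Type*} {m : ℕ} {t : A → T} {S F1 F2 : Finset (ℕ × ℕ)} {a b : T}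
    {g : ZMod m × Fin 2 → Option T} (h : Conf m t S F1 F2 a b g) {x y : ℕ} (hx : x < m)
    (hy : y < 2) (hF : (x, y) ∈ F1) : g (nd m x y) = some a :=
  h.2.2.1 _ (by rw [xc_nd hx, yc_nd hy]; exact hF)

lemma Conf.at2 {A T : Type*} {m : ℕ} {t : A → T} {S F1 F2 : Finset (ℕ × ℕ)} {a b : T}
    {g : ZMod m × Fin 2 → Option T} (h : Conf m t S F1 F2 a b g) {x y : ℕ} (hx : x < m)
    (hy : y < 2) (hF : (x, y) ∈ F2) : g (nd m x y) = some b :=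
  h.2.2.2 _ (by rw [xc_nd hx, yc_nd hy]; exact hF)

lemma Conf.occ {A T : Type*} {m : ℕ} {t : A → T} {S F1 F2 : Finset (ℕ × ℕ)} {a b : T}
    {g : ZMod m × Fin 2 → Option T} (h : Conf m t S F1 F2 a b g) {x y : ℕ} (hx : x < m)
    (hy : y < 2) (hF : (x, y) ∈ S) : ∃ c, g (nd m x y) = some c := by
  have := (h.2.1 (nd m x y)).2 (by rw [xc_nd hx, yc_nd hy]; exact hF)
  exact Option.ne_none_iff_exists'.1 this

/-- coordinate version of `equil_ok` -/
lemma conf_ok {A T : Type*} [Finite T] {m : ℕ} [NeZero m] (hm : 3 ≤ m) {t : A → T}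
    {S F1 F2 : Finset (ℕ × ℕ)} {a b : T}
    {g : ZMod m × Fin 2 → Option T} (h : Conf m t S F1 F2 a b g)
    (H : ∀ x y x1 y1, x < m → y < 2 → x1 < m → y1 < 2 → (x, y) ∈ S → (x1, y1) ∉ S →
      (∀ x2 y2, x2 < m → y2 < 2 → (x2, y2) ∈ S → ad m x1 y1 x2 y2 →
        x2 = x ∧ y2 = y ∨ g (nd m x2 y2) = g (nd m x y)) ∨
      ((∃ x2 y2, x2 < m ∧ y2 < 2 ∧ (x2, y2) ∈ S ∧ ad m x y x2 y2 ∧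
          g (nd m x2 y2) ≠ g (nd m x y)) ∧
        ∃ e, ∀ x2 y2, x2 < m → y2 < 2 → (x2, y2) ∈ S → ad m x1 y1 x2 y2 →
        x2 = x ∧ y2 = y ∨ g (nd m x2 y2) = g (nd m x y) ∨ g (nd m x2 y2) = some e) ∨
      ((∃ x2 y2 x3 y3, x2 < m ∧ y2 < 2 ∧ x3 < m ∧ y3 < 2 ∧ (x2, y2) ∈ S ∧ (x3, y3) ∈ S ∧
          ad m x y x2 y2 ∧ ad m x y x3 y3 ∧ g (nd m x2 y2) ≠ g (nd m x y) ∧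
          g (nd m x3 y3) ≠ g (nd m x y) ∧ g (nd m x2 y2) ≠ g (nd m x3 y3)) ∧
        ∃ e f, ∀ x2 y2, x2 < m → y2 < 2 → (x2, y2) ∈ S → ad m x1 y1 x2 y2 →
        x2 = x ∧ y2 = y ∨ g (nd m x2 y2) = g (nd m x y) ∨ g (nd m x2 y2) = some e ∨
          g (nd m x2 y2) = some f)) :
    ∃ σ : A ↪ ZMod m × Fin 2, IsEquilibrium (cylinderGraph m) t σ := by
  apply equil_ok h.1
  intro v w c hv hw
  have hvS : (xc v, yc v) ∈ S := (h.2.1 v).1 (by simp [hv])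
  have hwS : (xc w, yc w) ∉ S := fun k => (h.2.1 w).2 k hw
  have hS : ∀ {z d}, g z = some d → (xc z, yc z) ∈ S := fun {z d} k => (h.2.1 z).1 (by simp [k])
  rcases H _ _ _ _ (xc_lt v) (yc_lt v) (xc_lt w) (yc_lt w) hvS hwS with
    H | ⟨⟨x2, y2, k1, k2, k3, k4, k5⟩, e, H⟩ |
    ⟨⟨x2, y2, x3, y3, k1, k2, k3, k4, k5, k6, k7, k8, k9, k10, k11⟩, e, f, H⟩
  · left
    intro z d hz hzv hd
    rcases H _ _ (xc_lt z) (yc_lt z) (hS hd) ((cyl_ad hm).1 hz) with q | q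
    · exact absurd (nd_ext q.1 q.2) hzv
    · rw [nd_eta, nd_eta, hd, hv] at q; exact Option.some.inj q
  · right; left
    obtain ⟨d, hd⟩ := h.occ k1 k2 k3
    refine ⟨⟨_, d, cyl_ad' hm k1 k2 k4, hd, ?_⟩, e, ?_⟩
    · rintro rfl; rw [nd_eta, hd, hv] at k5; exact k5 rfl
    · intro z d hz hzv hd
      rcases H _ _ (xc_lt z) (yc_lt z) (hS hd) ((cyl_ad hm).1 hz) with q | q | q
      · exact absurd (nd_ext q.1 q.2) hzv
      · rw [nd_eta, nd_eta, hd, hv] at q; exact Or.inl (Option.some.inj q)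
      · rw [nd_eta, hd] at q; exact Or.inr (Option.some.inj q)
  · right; right
    obtain ⟨d, hd⟩ := h.occ k1 k2 k5
    obtain ⟨d', hd'⟩ := h.occ k3 k4 k6
    rw [nd_eta, hv] at k9 k10
    rw [hd] at k9 k11
    rw [hd'] at k10 k11
    refine ⟨⟨_, d, _, d', cyl_ad' hm k1 k2 k7, hd, ?_, cyl_ad' hm k3 k4 k8, hd', ?_, ?_⟩, e, f, ?_⟩
    · rintro rfl; exact k9 rfl
    · rintro rfl; exact k10 rfl
    · rintro rfl; exact k11 rfl
    · intro z d hz hzv hd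
      rcases H _ _ (xc_lt z) (yc_lt z) (hS hd) ((cyl_ad hm).1 hz) with q | q | q | q
      · exact absurd (nd_ext q.1 q.2) hzv
      · rw [nd_eta, nd_eta, hd, hv] at q; exact Or.inl (Option.some.inj q)
      · rw [nd_eta, hd] at q; exact Or.inr (Or.inl (Option.some.inj q))
      · rw [nd_eta, hd] at q; exact Or.inr (Or.inr (Option.some.inj q))

/-- coordinate version of `equil_star` -/
lemma conf_star {A T : Type*} [Finite T] {m : ℕ} [NeZero m] (hm : 3 ≤ m) {t : A → T}
    {S F1 F2 : Finset (ℕ × ℕ)} {a b : T}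
    {g : ZMod m × Fin 2 → Option T} (h : Conf m t S F1 F2 a b g)
    (H1 : ∀ x y x1 y1 x2 y2, x < m → y < 2 → x1 < m → y1 < 2 → x2 < m → y2 < 2 → (x, y) ∉ S →
      (x1, y1) ∈ S → (x2, y2) ∈ S → ad m x y x1 y1 → ad m x y x2 y2 →
      (x1 = x2 ∧ y1 = y2) ∨ g (nd m x1 y1) = g (nd m x2 y2))
    (H2 : ∀ x y, x < m → y < 2 → (x, y) ∈ S →
      (∃ x1 y1, x1 < m ∧ y1 < 2 ∧ (x1, y1) ∈ S ∧ ad m x y x1 y1 ∧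
        g (nd m x1 y1) ≠ g (nd m x y)) ∨
      (∀ x1 y1 x2 y2, x1 < m → y1 < 2 → x2 < m → y2 < 2 → (x1, y1) ∉ S → (x2, y2) ∈ S →
        ad m x1 y1 x2 y2 → g (nd m x2 y2) = g (nd m x y))) :
    ∃ σ : A ↪ ZMod m × Fin 2, IsEquilibrium (cylinderGraph m) t σ := by
  have hS : ∀ {z d}, g z = some d → (xc z, yc z) ∈ S := fun {z d} k => (h.2.1 z).1 (by simp [k])
  have hS' : ∀ {w}, g w = none → (xc w, yc w) ∉ S := fun {w} hw k => (h.2.1 w).2 k hw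
  apply equil_star h.1
  · intro w z z' d d' hw hz hz' hd hd'
    rcases H1 _ _ _ _ _ _ (xc_lt w) (yc_lt w) (xc_lt z) (yc_lt z) (xc_lt z') (yc_lt z') (hS' hw)
      (hS hd) (hS hd') ((cyl_ad hm).1 hz) ((cyl_ad hm).1 hz') with q | q
    · have := nd_ext q.1 q.2
      subst this
      rw [hd] at hd'; exact Option.some.inj hd'
    · rw [nd_eta, nd_eta, hd, hd'] at q; exact Option.some.inj q
  · intro v c hv
    rcases H2 _ _ (xc_lt v) (yc_lt v) (hS hv) with ⟨x2, y2, k1, k2, k3, k4, k5⟩ | H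
    · left
      obtain ⟨d, hd⟩ := h.occ k1 k2 k3
      refine ⟨_, d, cyl_ad' hm k1 k2 k4, hd, ?_⟩
      rintro rfl; rw [nd_eta, hd, hv] at k5; exact k5 rfl
    · right
      intro w z d hw hz hd
      have q := H _ _ _ _ (xc_lt w) (yc_lt w) (xc_lt z) (yc_lt z) (hS' hw) (hS hd)
        ((cyl_ad hm).1 hz)
      rw [nd_eta, nd_eta, hd, hv] at q; exact Option.some.inj q

/-- even number of agents, dominant type -/
lemma even_dom {A T : Type*} [Fintype A] [Finite T] {m : ℕ} [NeZero m] (hm : 3 ≤ m) (t : A → T)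
    (p : ℕ) (hp : 3 ≤ p) (hpm : p + 1 ≤ m) (hn : Fintype.card A = 2 * p) (a b : T) (hab : a ≠ b)
    (ha : p + 1 ≤ cnt t a) :
    ∃ σ : A ↪ ZMod m × Fin 2, IsEquilibrium (cylinderGraph m) t σ := by
  classical
  set S : Finset (ℕ × ℕ) := Finset.Icc 1 p ×ˢ Finset.range 2 with hS
  set F : Finset (ℕ × ℕ) := insert (1, 0) (insert (p, 0) (insert (1, 1) (Finset.Icc 3 p ×ˢ {1})))
    with hF
  have mS : ∀ x y, (x, y) ∈ S ↔ (1 ≤ x ∧ x ≤ p) ∧ y < 2 := by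
    intro x y; simp [hS]
  have mF : ∀ x y, (x, y) ∈ F ↔ (x = 1 ∧ y = 0) ∨ (x = p ∧ y = 0) ∨ (x = 1 ∧ y = 1) ∨
      ((3 ≤ x ∧ x ≤ p) ∧ y = 1) := by
    intro x y; simp [hF]; omega
  obtain ⟨g, hg⟩ := exists_conf (m := m) t S F ∅ a b
    (by rintro ⟨x, y⟩ h; rw [mS] at h; simp only; omega)
    (by rw [hn, hS]; simp; ring)
    (by rintro ⟨x, y⟩ h; rw [mF] at h; rw [mS]; omega)
    (by simp) (by simp) hab
    (by
      refine le_trans ?_ ha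
      rw [hF]
      refine (Finset.card_insert_le _ _).trans ?_
      have h1 := Finset.card_insert_le (p, 0) (insert (1, 1) (Finset.Icc 3 p ×ˢ ({1} : Finset ℕ)))
      have h2 := Finset.card_insert_le (1, 1) (Finset.Icc 3 p ×ˢ ({1} : Finset ℕ))
      have h3 : (Finset.Icc 3 p ×ˢ ({1} : Finset ℕ)).card = p - 2 := by simp
      omega) (by simp)
  have fa : ∀ x y, x < m → y < 2 → (x, y) ∈ F → g (nd m x y) = some a := fun x y h1 h2 h3 =>
    hg.at1 h1 h2 h3
  have fr : ∀ x y x1 y1, x < m → y < 2 → x1 < m → y1 < 2 → (x, y) ∉ S →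
      (x1, y1) ∈ S → ad m x y x1 y1 → g (nd m x1 y1) = some a := by
    intro x y x1 y1 h1 h2 h3 h4 h5 h6 h7
    apply fa _ _ h3 h4
    rw [mS] at h5 h6; rw [mF]; unfold ad at h7; omega
  apply conf_star hm hg
  · intro x y x1 y1 x2 y2 hx hy hx1 hy1 hx2 hy2 h0 h1 h2 k1 k2
    right
    rw [fr x y x1 y1 hx hy hx1 hy1 h0 h1 k1, fr x y x2 y2 hx hy hx2 hy2 h0 h2 k2]
  · intro x y hx hy hxy
    by_cases hc : g (nd m x y) = some a
    · right
      intro x1 y1 x2 y2 k1 k2 k3 k4 k5 k6 k7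
      rw [hc]; exact fr x1 y1 x2 y2 k1 k2 k3 k4 k5 k6 k7
    · left
      have hnF : (x, y) ∉ F := fun h => hc (fa x y hx hy h)
      have : ∃ x1 y1, x1 < m ∧ y1 < 2 ∧ (x1, y1) ∈ F ∧ (x1, y1) ∈ S ∧ ad m x y x1 y1 := by
        rw [mF] at hnF; rw [mS] at hxy
        by_cases h2 : x = 2
        · refine ⟨1, y, ?_⟩
          rw [mF, mS]; unfold ad; omega
        · refine ⟨x, 1, ?_⟩
          rw [mF, mS]; unfold ad; omega
      obtain ⟨x1, y1, k1, k2, k3, k4, k5⟩ := this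
      refine ⟨x1, y1, k1, k2, k4, k5, ?_⟩
      rw [fa x1 y1 k1 k2 k3]; exact fun h => hc h.symm

/-- odd number of agents, dominant type -/
lemma odd_dom {A T : Type*} [Fintype A] [Finite T] {m : ℕ} [NeZero m] (hm : 3 ≤ m) (t : A → T)
    (p : ℕ) (hp : 1 ≤ p) (hpm : p + 2 ≤ m) (hn : Fintype.card A = 2 * p + 1) (a b : T)
    (hab : a ≠ b) (ha : p + 2 ≤ cnt t a) :
    ∃ σ : A ↪ ZMod m × Fin 2, IsEquilibrium (cylinderGraph m) t σ := by
  classical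
  set S : Finset (ℕ × ℕ) := insert (p + 1, 0) (Finset.Icc 1 p ×ˢ Finset.range 2) with hS
  set F : Finset (ℕ × ℕ) := insert (1, 0) (insert (p + 1, 0) (Finset.Icc 1 p ×ˢ {1}))
    with hF
  have mS : ∀ x y, (x, y) ∈ S ↔ (x = p + 1 ∧ y = 0) ∨ (1 ≤ x ∧ x ≤ p) ∧ y < 2 := by
    intro x y; simp [hS]
  have mF : ∀ x y, (x, y) ∈ F ↔ (x = 1 ∧ y = 0) ∨ (x = p + 1 ∧ y = 0) ∨
      ((1 ≤ x ∧ x ≤ p) ∧ y = 1) := by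
    intro x y; simp [hF]; omega
  obtain ⟨g, hg⟩ := exists_conf (m := m) t S F ∅ a b
    (by rintro ⟨x, y⟩ h; rw [mS] at h; simp only; omega)
    (by rw [hn, hS, Finset.card_insert_of_notMem (by simp)]; simp; ring)
    (by rintro ⟨x, y⟩ h; rw [mF] at h; rw [mS]; omega)
    (by simp) (by simp) hab
    (by
      refine le_trans ?_ ha
      rw [hF]
      refine (Finset.card_insert_le _ _).trans ?_
      have h1 := Finset.card_insert_le (p + 1, 0) (Finset.Icc 1 p ×ˢ ({1} : Finset ℕ))
      have h3 : (Finset.Icc 1 p ×ˢ ({1} : Finset ℕ)).card = p := by simp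
      omega) (by simp)
  have fa : ∀ x y, x < m → y < 2 → (x, y) ∈ F → g (nd m x y) = some a := fun x y h1 h2 h3 =>
    hg.at1 h1 h2 h3
  have fr : ∀ x y x1 y1, x < m → y < 2 → x1 < m → y1 < 2 → (x, y) ∉ S →
      (x1, y1) ∈ S → ad m x y x1 y1 → g (nd m x1 y1) = some a := by
    intro x y x1 y1 h1 h2 h3 h4 h5 h6 h7
    apply fa _ _ h3 h4
    rw [mS] at h5 h6; rw [mF]; unfold ad at h7; omega
  apply conf_star hm hg
  · intro x y x1 y1 x2 y2 hx hy hx1 hy1 hx2 hy2 h0 h1 h2 k1 k2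
    right
    rw [fr x y x1 y1 hx hy hx1 hy1 h0 h1 k1, fr x y x2 y2 hx hy hx2 hy2 h0 h2 k2]
  · intro x y hx hy hxy
    by_cases hc : g (nd m x y) = some a
    · right
      intro x1 y1 x2 y2 k1 k2 k3 k4 k5 k6 k7
      rw [hc]; exact fr x1 y1 x2 y2 k1 k2 k3 k4 k5 k6 k7
    · left
      have hnF : (x, y) ∉ F := fun h => hc (fa x y hx hy h)
      have : ∃ x1 y1, x1 < m ∧ y1 < 2 ∧ (x1, y1) ∈ F ∧ (x1, y1) ∈ S ∧ ad m x y x1 y1 := by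
        rw [mF] at hnF; rw [mS] at hxy
        refine ⟨x, 1, ?_⟩
        rw [mF, mS]; unfold ad; omega
      obtain ⟨x1, y1, k1, k2, k3, k4, k5⟩ := this
      refine ⟨x1, y1, k1, k2, k4, k5, ?_⟩
      rw [fa x1 y1 k1 k2 k3]; exact fun h => hc h.symm

/-- three agents of one type and one of another -/
lemma even_four {A T : Type*} [Fintype A] [Finite T] {m : ℕ} [NeZero m] (hm : 3 ≤ m) (t : A → T)
    (hn : Fintype.card A = 4) (a b : T) (hab : a ≠ b)
    (ha : cnt t a = 3) :
    ∃ σ : A ↪ ZMod m × Fin 2, IsEquilibrium (cylinderGraph m) t σ := by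
  classical
  set S : Finset (ℕ × ℕ) := {(0, 0), (1, 0), (2, 0), (1, 1)} with hS
  set F : Finset (ℕ × ℕ) := {(0, 0), (2, 0), (1, 1)} with hF
  have mS : ∀ x y, (x, y) ∈ S ↔ (x = 0 ∧ y = 0) ∨ (x = 1 ∧ y = 0) ∨ (x = 2 ∧ y = 0) ∨
      (x = 1 ∧ y = 1) := by
    intro x y; simp [hS]
  have mF : ∀ x y, (x, y) ∈ F ↔ (x = 0 ∧ y = 0) ∨ (x = 2 ∧ y = 0) ∨ (x = 1 ∧ y = 1) := by
    intro x y; simp [hF]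
  obtain ⟨g, hg⟩ := exists_conf (m := m) t S F ∅ a b
    (by rintro ⟨x, y⟩ h; rw [mS] at h; simp only; omega)
    (by rw [hn, hS]; simp)
    (by rintro ⟨x, y⟩ h; rw [mF] at h; rw [mS]; omega)
    (by simp) (by simp) hab
    (by rw [ha, hF]; simp) (by simp)
  have fa : ∀ x y, x < m → y < 2 → (x, y) ∈ F → g (nd m x y) = some a := fun x y h1 h2 h3 =>
    hg.at1 h1 h2 h3
  obtain ⟨c, hc⟩ := hg.occ (x := 1) (y := 0) (by omega) (by omega) (by rw [mS]; omega)
  have hca : c ≠ a := by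
    rintro rfl
    have := hg.1.le_cnt' c S (by
      rintro ⟨x, y⟩ h
      rw [mS] at h
      refine ⟨by simp only; omega, by simp only; omega, ?_⟩
      simp only
      by_cases k : x = 1 ∧ y = 0
      · rw [k.1, k.2]; exact hc
      · exact fa x y (by omega) (by omega) (by rw [mF]; omega))
    rw [ha, hS] at this
    simp at this
  have all : ∀ x y, x < m → y < 2 → (x, y) ∈ S → g (nd m x y) = some a ∨ g (nd m x y) = some c := by
    intro x y h1 h2 h3
    by_cases k : x = 1 ∧ y = 0
    · rw [k.1, k.2]; exact Or.inr hc
    · left; apply fa _ _ h1 h2; rw [mF]; rw [mS] at h3; omega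
  apply conf_ok hm hg
  intro x y x1 y1 hx hy hx1 hy1 h h1
  right; left
  by_cases k : x = 1 ∧ y = 0
  · obtain ⟨rfl, rfl⟩ := k
    refine ⟨⟨0, 0, by omega, by omega, by rw [mS]; omega, by unfold ad; omega, ?_⟩, a, ?_⟩
    · rw [hc, fa 0 0 (by omega) (by omega) (by rw [mF]; omega)]
      exact fun h => hca (Option.some.inj h).symm
    · intro x2 y2 k1 k2 k3 k4
      rw [hc]
      have := all x2 y2 k1 k2 k3
      tauto
  · have hxa := fa x y hx hy (by rw [mF]; rw [mS] at h; omega)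
    refine ⟨⟨1, 0, by omega, by omega, by rw [mS]; omega, by rw [mS] at h; unfold ad; omega, ?_⟩,
      c, ?_⟩
    · rw [hc, hxa]
      exact fun h => hca (Option.some.inj h)
    · intro x2 y2 k1 k2 k3 k4
      rw [hxa]
      have := all x2 y2 k1 k2 k3
      tauto

/-- even number of agents, balanced, at least four empty nodes -/
lemma even_bal {A T : Type*} [Fintype A] [Finite T] {m : ℕ} [NeZero m] (hm : 3 ≤ m) (t : A → T)
    (p : ℕ) (hpm : p + 2 ≤ m) (hn : Fintype.card A = 2 * p) (a b : T) (hab : a ≠ b)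
    (hle : ∀ c, cnt t c ≤ p) :
    ∃ σ : A ↪ ZMod m × Fin 2, IsEquilibrium (cylinderGraph m) t σ := by
  classical
  set S : Finset (ℕ × ℕ) := Finset.Icc 1 p ×ˢ Finset.range 2 with hS
  have mS : ∀ x y, (x, y) ∈ S ↔ (1 ≤ x ∧ x ≤ p) ∧ y < 2 := by
    intro x y; simp [hS]
  obtain ⟨g, hg, hcol⟩ := exists_cols (m := m) t S ∅ ∅ a b
    (by rintro ⟨x, y⟩ h; rw [mS] at h; simp only; omega)
    (by rw [hn, hS]; simp; ring)
    (by simp) (by simp) (by simp) hab (by simp) (by simp) 1 p (by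
      intro x h1 h2
      refine ⟨by rw [mS]; omega, by rw [mS]; omega, 0, by omega, by simp⟩)
  have bi : ∀ x, 1 ≤ x → x ≤ p → g (nd m x 0) ≠ g (nd m x 1) := by
    intro x h1 h2 h
    obtain ⟨C, hC⟩ := hg.occ (x := x) (y := 0) (by omega) (by omega) (by rw [mS]; omega)
    have hC' := h ▸ hC
    have := count_cols hg.1 C 1 p x (by omega) (hcol x C h1 h2 hC hC') h1 h2 hC hC' ∅ (by simp)
    have := hle C
    simp at *
    omega
  apply conf_star hm hg
  · intro x y x1 y1 x2 y2 hx hy hx1 hy1 hx2 hy2 h0 h1 h2 k1 k2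
    left
    rw [mS] at h0 h1 h2; unfold ad at k1 k2
    omega
  · intro x y hx hy hxy
    left
    rw [mS] at hxy
    refine ⟨x, 1 - y, by omega, by omega, by rw [mS]; omega, by unfold ad; omega, ?_⟩
    have := bi x (by omega) (by omega)
    have hy' : y = 0 ∨ y = 1 := by omega
    rcases hy' with rfl | rfl
    · exact this.symm
    · exact this

lemma Cfg.two_le {A T : Type*} [Fintype A] {m : ℕ} [NeZero m] {t : A → T}
    {g : ZMod m × Fin 2 → Option T} (hg : Cfg t g) {x y x' y' : ℕ} {c : T} (hx : x < m)
    (hy : y < 2) (hx' : x' < m) (hy' : y' < 2) (h : g (nd m x y) = some c)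
    (h' : g (nd m x' y') = some c) (hne : ¬ (x = x' ∧ y = y')) : 2 ≤ cnt t c := by
  classical
  have := hg.le_cnt' c {(x, y), (x', y')} (by
    intro q hq
    rw [Finset.mem_insert, Finset.mem_singleton] at hq
    rcases hq with rfl | rfl
    · exact ⟨hx, hy, h⟩
    · exact ⟨hx', hy', h'⟩)
  rwa [Finset.card_pair (by simpa using hne)] at this

lemma Conf.uniq {A T : Type*} [Fintype A] {m : ℕ} [NeZero m] {t : A → T}
    {S F F2 : Finset (ℕ × ℕ)} {a b : T}
    {g : ZMod m × Fin 2 → Option T} (hg : Conf m t S F F2 a b g) (hs : ∀ c, c ≠ a → cnt t c ≤ 1)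
    (hF : cnt t a ≤ F.card) (hFS : ∀ q ∈ F, q.1 < m ∧ q.2 < 2) {x y x' y' : ℕ} (hx : x < m)
    (hy : y < 2) (hx' : x' < m) (hy' : y' < 2) (hS : (x, y) ∈ S)
    (hne : ¬ (x = x' ∧ y = y')) (h : g (nd m x y) = g (nd m x' y')) :
    (x, y) ∈ F ∧ (x', y') ∈ F := by
  classical
  obtain ⟨c, hc⟩ := hg.occ hx hy hS
  have hc' := h ▸ hc
  have h2 := hg.1.two_le hx hy hx' hy' hc hc' hne
  have : c = a := by
    by_contra k
    have := hs c k
    omega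
  subst this
  have key : ∀ z w, z < m → w < 2 → g (nd m z w) = some c → (z, w) ∈ F := by
    intro z w hz hw hzw
    by_contra k
    have := hg.1.le_cnt' c (insert (z, w) F) (by
      intro q hq
      rcases Finset.mem_insert.1 hq with rfl | hq
      · exact ⟨hz, hw, hzw⟩
      · exact ⟨(hFS q hq).1, (hFS q hq).2, hg.at1 (hFS q hq).1 (hFS q hq).2 hq⟩)
    rw [Finset.card_insert_of_notMem k] at this
    omega
  have r := key _ _ hx' hy' hc'
  exact ⟨key _ _ hx hy hc, r⟩

/-- two empty nodes, two types with at least two agents -/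
lemma two_bal {A T : Type*} [Fintype A] [Finite T] {m : ℕ} [NeZero m] (hm : 3 ≤ m) (t : A → T)
    (p : ℕ) (hpm : p + 1 = m) (hn : Fintype.card A = 2 * p) (a b : T) (hab : a ≠ b)
    (hle : ∀ c, cnt t c ≤ p) (hb : 2 ≤ cnt t b) (hba : cnt t b ≤ cnt t a)
    (hmax : ∀ c, c ≠ a → cnt t c ≤ cnt t b) :
    ∃ σ : A ↪ ZMod m × Fin 2, IsEquilibrium (cylinderGraph m) t σ := by
  classical
  set S : Finset (ℕ × ℕ) := Finset.Icc 1 p ×ˢ Finset.range 2 with hS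
  have mS : ∀ x y, (x, y) ∈ S ↔ (1 ≤ x ∧ x ≤ p) ∧ y < 2 := by
    intro x y; simp [hS]
  set F1 : Finset (ℕ × ℕ) := {(1, 0), (p, 0)} with hF1
  set F2 : Finset (ℕ × ℕ) := {(1, 1), (p, 1)} with hF2
  have m1 : ∀ x y, (x, y) ∈ F1 ↔ (x = 1 ∧ y = 0) ∨ (x = p ∧ y = 0) := by
    intro x y; simp [hF1]
  have m2 : ∀ x y, (x, y) ∈ F2 ↔ (x = 1 ∧ y = 1) ∨ (x = p ∧ y = 1) := by
    intro x y; simp [hF2]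
  have c1 : F1.card = 2 := by rw [hF1, Finset.card_pair]; simp; omega
  have c2 : F2.card = 2 := by rw [hF2, Finset.card_pair]; simp; omega
  obtain ⟨g, hg, hcol⟩ := exists_cols (m := m) t S F1 F2 a b
    (by rintro ⟨x, y⟩ h; rw [mS] at h; simp only; omega)
    (by rw [hn, hS]; simp; ring)
    (by rintro ⟨x, y⟩ h; rw [m1] at h; rw [mS]; omega)
    (by rintro ⟨x, y⟩ h; rw [m2] at h; rw [mS]; omega)
    (by rw [Finset.disjoint_left]; rintro ⟨x, y⟩ h h'; rw [m1] at h; rw [m2] at h'; omega)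
    hab (by omega) (by omega) 2 (p - 1) (by
      intro x h1 h2
      refine ⟨by rw [mS]; omega, by rw [mS]; omega, 0, by omega, ?_⟩
      rw [Finset.mem_union, m1, m2]; omega)
  have f1 : ∀ x, x = 1 ∨ x = p → g (nd m x 0) = some a := fun x h =>
    hg.at1 (by omega) (by omega) (by rw [m1]; omega)
  have f2 : ∀ x, x = 1 ∨ x = p → g (nd m x 1) = some b := fun x h =>
    hg.at2 (by omega) (by omega) (by rw [m2]; omega)
  have bi : ∀ x, 1 ≤ x → x ≤ p → x ≠ 2 ∨ p = 2 → g (nd m x 0) ≠ g (nd m x 1) := by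
    intro x h1 h2 hx2 h
    by_cases hxe : x = 1 ∨ x = p
    · rw [f1 x hxe, f2 x hxe] at h; exact hab (Option.some.inj h)
    obtain ⟨C, hC⟩ := hg.occ (x := x) (y := 0) (by omega) (by omega) (by rw [mS]; omega)
    have hC' := h ▸ hC
    have hcol' := hcol x C (by omega) (by omega) hC hC'
    have cc := fun E hE => count_cols hg.1 C 2 (p - 1) x (by omega) hcol' (by omega) (by omega)
      hC hC' E hE
    have hl := hle C
    by_cases ka : C = a
    · subst ka
      have := cc F1 (by
        rintro ⟨u, v⟩ hq; rw [m1] at hq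
        exact ⟨by simp only; omega, by simp only; omega,
          hg.at1 (by simp only; omega) (by simp only; omega) (by simp only; rw [m1]; omega),
          by simp only; omega⟩)
      omega
    by_cases kb : C = b
    · subst kb
      have := cc F2 (by
        rintro ⟨u, v⟩ hq; rw [m2] at hq
        exact ⟨by simp only; omega, by simp only; omega,
          hg.at2 (by simp only; omega) (by simp only; omega) (by simp only; rw [m2]; omega),
          by simp only; omega⟩)
      omega
    · have := cc ∅ (by simp)
      have q1 := hmax C ka
      have q2 := cnt_add3 t hab (Ne.symm ka) (Ne.symm kb)
      simp only [Finset.card_empty] at this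
      omega
  apply conf_star hm hg
  · intro x y x1 y1 x2 y2 hx hy hx1 hy1 hx2 hy2 h0 h1 h2 k1 k2
    right
    rw [mS] at h0 h1 h2; unfold ad at k1 k2
    have e1 : y1 = y2 := by omega
    subst e1
    have : y1 = 0 ∨ y1 = 1 := by omega
    rcases this with rfl | rfl
    · rw [f1 x1 (by omega), f1 x2 (by omega)]
    · rw [f2 x1 (by omega), f2 x2 (by omega)]
  · intro x y hx hy hxy
    left
    rw [mS] at hxy
    have hy' : y = 0 ∨ y = 1 := by omega
    by_cases hbi : g (nd m x 0) = g (nd m x 1)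
    · have hx2 : x = 2 ∧ p ≠ 2 := by
        by_contra k
        exact bi x (by omega) (by omega) (by omega) hbi
      obtain ⟨rfl, hp2⟩ := hx2
      have hyy : g (nd m 2 y) = g (nd m 2 0) := by
        rcases hy' with rfl | rfl
        · rfl
        · exact hbi.symm
      -- the column is monochromatic, so its type is neither `a` nor `b`, or a neighbour differs
      refine ⟨1, y, by omega, by omega, by rw [mS]; omega, by unfold ad; omega, ?_⟩
      intro hne
      obtain ⟨C, hC⟩ := hg.occ (x := 2) (y := 0) (by omega) (by omega) (by rw [mS]; omega)
      have hC' := hbi ▸ hC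
      have hcol' := hcol 2 C (by omega) (by omega) hC hC'
      have cc := fun E hE => count_cols hg.1 C 2 (p - 1) 2 (by omega) hcol' (by omega) (by omega)
        hC hC' E hE
      have hl := hle C
      rcases hy' with rfl | rfl
      · rw [f1 1 (by omega), hC] at hne
        obtain rfl := Option.some.inj hne
        have := cc F1 (by
          rintro ⟨u, v⟩ hq; rw [m1] at hq
          exact ⟨by simp only; omega, by simp only; omega,
            hg.at1 (by simp only; omega) (by simp only; omega) (by simp only; rw [m1]; omega),
            by simp only; omega⟩)
        omega
      · rw [f2 1 (by omega), hC'] at hne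
        obtain rfl := Option.some.inj hne
        have := cc F2 (by
          rintro ⟨u, v⟩ hq; rw [m2] at hq
          exact ⟨by simp only; omega, by simp only; omega,
            hg.at2 (by simp only; omega) (by simp only; omega) (by simp only; rw [m2]; omega),
            by simp only; omega⟩)
        omega
    refine ⟨x, 1 - y, by omega, by omega, by rw [mS]; omega, by unfold ad; omega, ?_⟩
    rcases hy' with rfl | rfl
    · exact fun h => hbi h.symm
    · exact hbi

/-- two empty nodes, one type with at least four agents, all others singletons -/
lemma two_four {A T : Type*} [Fintype A] [Finite T] {m : ℕ} [NeZero m] (hm : 3 ≤ m) (t : A → T)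
    (p : ℕ) (hpm : p + 1 = m) (hn : Fintype.card A = 2 * p) (a b : T) (hab : a ≠ b)
    (ha : 4 ≤ cnt t a) (hs : ∀ c, c ≠ a → cnt t c ≤ 1) :
    ∃ σ : A ↪ ZMod m × Fin 2, IsEquilibrium (cylinderGraph m) t σ := by
  classical
  set S : Finset (ℕ × ℕ) := Finset.Icc 1 p ×ˢ Finset.range 2 with hS
  have mS : ∀ x y, (x, y) ∈ S ↔ (1 ≤ x ∧ x ≤ p) ∧ y < 2 := by
    intro x y; simp [hS]
  set F : Finset (ℕ × ℕ) := ({1, p} : Finset ℕ) ×ˢ Finset.range 2 with hF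
  have mF : ∀ x y, (x, y) ∈ F ↔ (x = 1 ∨ x = p) ∧ y < 2 := by
    intro x y; simp [hF]
  have c1 : F.card ≤ 4 := by
    rw [hF, Finset.card_product]
    have : ({1, p} : Finset ℕ).card ≤ 2 := Finset.card_le_two
    simp only [Finset.card_range]; omega
  obtain ⟨g, hg⟩ := exists_conf (m := m) t S F ∅ a b
    (by rintro ⟨x, y⟩ h; rw [mS] at h; simp only; omega)
    (by rw [hn, hS]; simp; ring)
    (by rintro ⟨x, y⟩ h; rw [mF] at h; rw [mS]; omega)
    (by simp) (by simp) hab (by omega) (by simp)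
  have fr : ∀ x y x1 y1, x < m → y < 2 → x1 < m → y1 < 2 → (x, y) ∉ S →
      (x1, y1) ∈ S → ad m x y x1 y1 → g (nd m x1 y1) = some a := by
    intro x y x1 y1 h1 h2 h3 h4 h5 h6 h7
    apply hg.at1 h3 h4
    rw [mS] at h5 h6; rw [mF]; unfold ad at h7; omega
  apply conf_star hm hg
  · intro x y x1 y1 x2 y2 hx hy hx1 hy1 hx2 hy2 h0 h1 h2 k1 k2
    right
    rw [fr x y x1 y1 hx hy hx1 hy1 h0 h1 k1, fr x y x2 y2 hx hy hx2 hy2 h0 h2 k2]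
  · intro x y hx hy hxy
    by_cases hc : g (nd m x y) = some a
    · right
      intro x1 y1 x2 y2 k1 k2 k3 k4 k5 k6 k7
      rw [hc]; exact fr x1 y1 x2 y2 k1 k2 k3 k4 k5 k6 k7
    · left
      have hxy' := (mS _ _).1 hxy
      refine ⟨x, 1 - y, by omega, by omega, by rw [mS]; omega, by unfold ad; omega, ?_⟩
      intro h
      obtain ⟨c, hc'⟩ := hg.occ hx hy hxy
      have h2 := hg.1.two_le hx (by omega) hx hy (h.trans hc') hc' (by omega)
      have : c ≠ a := by rintro rfl; exact hc hc'
      have := hs c this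
      omega

/-- two empty nodes, one type with three agents, all others singletons -/
lemma two_three {A T : Type*} [Fintype A] [Finite T] {m : ℕ} [NeZero m] (hm : 4 ≤ m) (t : A → T)
    (p : ℕ) (hpm : p + 1 = m) (hn : Fintype.card A = 2 * p) (a b : T) (hab : a ≠ b)
    (ha : cnt t a = 3) (hs : ∀ c, c ≠ a → cnt t c ≤ 1) :
    ∃ σ : A ↪ ZMod m × Fin 2, IsEquilibrium (cylinderGraph m) t σ := by
  classical
  set S : Finset (ℕ × ℕ) := Finset.Icc 1 p ×ˢ Finset.range 2 with hS
  have mS : ∀ x y, (x, y) ∈ S ↔ (1 ≤ x ∧ x ≤ p) ∧ y < 2 := by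
    intro x y; simp [hS]
  set F : Finset (ℕ × ℕ) := {(1, 0), (p, 0), (1, 1)} with hF
  have mF : ∀ x y, (x, y) ∈ F ↔ (x = 1 ∧ y = 0) ∨ (x = p ∧ y = 0) ∨ (x = 1 ∧ y = 1) := by
    intro x y; simp [hF]
  have c1 : F.card = 3 := by
    rw [hF, Finset.card_eq_three]
    exact ⟨_, _, _, by simp; omega, by simp, by simp, rfl⟩
  obtain ⟨g, hg⟩ := exists_conf (m := m) t S F ∅ a b
    (by rintro ⟨x, y⟩ h; rw [mS] at h; simp only; omega)
    (by rw [hn, hS]; simp; ring)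
    (by rintro ⟨x, y⟩ h; rw [mF] at h; rw [mS]; omega)
    (by simp) (by simp) hab (by omega) (by simp)
  have un : ∀ x y x' y', (x, y) ∈ S → (x', y') ∈ S → ¬ (x = x' ∧ y = y') →
      ¬ ((x, y) ∈ F ∧ (x', y') ∈ F) → g (nd m x y) ≠ g (nd m x' y') := by
    intro x y x' y' h1 h2 h3 h4 h
    apply h4
    have h1' := (mS _ _).1 h1
    have h2' := (mS _ _).1 h2
    exact hg.uniq hs (by omega) (by rintro ⟨x, y⟩ h; rw [mF] at h; simp only; omega)
      (by omega) (by omega) (by omega) (by omega) h1 h3 h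
  have fa : ∀ x y, (x, y) ∈ F → g (nd m x y) = some a := by
    intro x y h
    have h' := (mF _ _).1 h
    exact hg.at1 (by omega) (by omega) h
  obtain ⟨e, he⟩ := hg.occ (x := p) (y := 1) (by omega) (by omega) (by rw [mS]; omega)
  have fr : ∀ x1 y1 x2 y2, x1 < m → y1 < 2 → (x1, y1) ∉ S → (x2, y2) ∈ S → ad m x1 y1 x2 y2 →
      g (nd m x2 y2) = some a ∨ g (nd m x2 y2) = some e := by
    intro x1 y1 x2 y2 h1 h2 h3 h4 h5
    by_cases k : (x2, y2) ∈ F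
    · exact Or.inl (fa _ _ k)
    · right
      rw [mF] at k; rw [mS] at h3 h4; unfold ad at h5
      have e1 : x2 = p := by omega
      have e2 : y2 = 1 := by omega
      rw [e1, e2]; exact he
  apply conf_ok (by omega) hg
  intro x y x1 y1 hx hy hx1 hy1 h h1
  have h' := (mS _ _).1 h
  by_cases k : (x, y) ∈ F
  · right; left
    rw [fa x y k]
    refine ⟨?_, e, ?_⟩
    · rw [← fa x y k]
      have k' := (mF _ _).1 k
      by_cases hxp : x = p
      · refine ⟨x, 1 - y, hx, by omega, by rw [mS]; omega, by unfold ad; omega, ?_⟩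
        apply un _ _ _ _ (by rw [mS]; omega) h (by omega)
        rw [mF, mF]; omega
      · refine ⟨2, y, by omega, by omega, by rw [mS]; omega, by unfold ad; omega, ?_⟩
        apply un _ _ _ _ (by rw [mS]; omega) h (by omega)
        rw [mF, mF]; omega
    · intro x2 y2 k1 k2 k3 k4
      exact Or.inr (fr x1 y1 x2 y2 hx1 hy1 h1 k3 k4)
  · right; right
    refine ⟨?_, a, e, ?_⟩
    · have k' := k
      rw [mF] at k'
      refine ⟨x, 1 - y, x - 1, y, by omega, by omega, by omega, by omega, by rw [mS]; omega,
        by rw [mS]; omega, by unfold ad; omega, by unfold ad; omega, ?_, ?_, ?_⟩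
      · apply un _ _ _ _ (by rw [mS]; omega) h (by omega)
        exact fun q => k q.2
      · apply un _ _ _ _ (by rw [mS]; omega) h (by omega)
        exact fun q => k q.2
      · apply un _ _ _ _ (by rw [mS]; omega) (by rw [mS]; omega) (by omega)
        rw [mF, mF]; omega
    · intro x2 y2 k1 k2 k3 k4
      exact Or.inr (Or.inr (fr x1 y1 x2 y2 hx1 hy1 h1 k3 k4))

/-- two empty nodes, one type with two agents, all others singletons -/
lemma two_two {A T : Type*} [Fintype A] [Finite T] {m : ℕ} [NeZero m] (hm : 4 ≤ m) (t : A → T)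
    (p : ℕ) (hpm : p + 1 = m) (hn : Fintype.card A = 2 * p) (a b : T) (hab : a ≠ b)
    (ha : cnt t a = 2) (hs : ∀ c, c ≠ a → cnt t c ≤ 1) :
    ∃ σ : A ↪ ZMod m × Fin 2, IsEquilibrium (cylinderGraph m) t σ := by
  classical
  set S : Finset (ℕ × ℕ) := Finset.Icc 1 p ×ˢ Finset.range 2 with hS
  have mS : ∀ x y, (x, y) ∈ S ↔ (1 ≤ x ∧ x ≤ p) ∧ y < 2 := by
    intro x y; simp [hS]
  set F : Finset (ℕ × ℕ) := {(1, 0), (p, 0)} with hF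
  have mF : ∀ x y, (x, y) ∈ F ↔ (x = 1 ∧ y = 0) ∨ (x = p ∧ y = 0) := by
    intro x y; simp [hF]
  have c1 : F.card = 2 := by rw [hF, Finset.card_pair]; simp; omega
  obtain ⟨g, hg⟩ := exists_conf (m := m) t S F ∅ a b
    (by rintro ⟨x, y⟩ h; rw [mS] at h; simp only; omega)
    (by rw [hn, hS]; simp; ring)
    (by rintro ⟨x, y⟩ h; rw [mF] at h; rw [mS]; omega)
    (by simp) (by simp) hab (by omega) (by simp)
  have un : ∀ x y x' y', (x, y) ∈ S → (x', y') ∈ S → ¬ (x = x' ∧ y = y') →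
      ¬ ((x, y) ∈ F ∧ (x', y') ∈ F) → g (nd m x y) ≠ g (nd m x' y') := by
    intro x y x' y' h1 h2 h3 h4 h
    apply h4
    have h1' := (mS _ _).1 h1
    have h2' := (mS _ _).1 h2
    exact hg.uniq hs (by omega) (by rintro ⟨x, y⟩ h; rw [mF] at h; simp only; omega)
      (by omega) (by omega) (by omega) (by omega) h1 h3 h
  apply conf_ok (by omega) hg
  intro x y x1 y1 hx hy hx1 hy1 h h1
  have h' := (mS _ _).1 h
  right; right
  refine ⟨?_, ?_⟩
  · obtain ⟨z, hz⟩ : ∃ z, (1 ≤ z ∧ z ≤ p) ∧ ((x = 1 ∧ z = 2) ∨ (x ≠ 1 ∧ z + 1 = x)) := by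
      by_cases hx1 : x = 1
      · exact ⟨2, by omega, by omega⟩
      · exact ⟨x - 1, by omega, by omega⟩
    refine ⟨x, 1 - y, z, y, by omega, by omega, by omega, by omega, by rw [mS]; omega,
      by rw [mS]; omega, by unfold ad; omega, by unfold ad; omega, ?_, ?_, ?_⟩
    · apply un _ _ _ _ (by rw [mS]; omega) h (by omega)
      rw [mF, mF]; omega
    · apply un _ _ _ _ (by rw [mS]; omega) h (by omega)
      rw [mF, mF]; omega
    · apply un _ _ _ _ (by rw [mS]; omega) (by rw [mS]; omega) (by omega)
      rw [mF, mF]; omega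
  · obtain ⟨e, he⟩ := hg.occ (x := 1) (y := y1) (by omega) (by omega) (by rw [mS]; omega)
    obtain ⟨f, hf⟩ := hg.occ (x := p) (y := y1) (by omega) (by omega) (by rw [mS]; omega)
    refine ⟨e, f, ?_⟩
    intro x2 y2 k1 k2 k3 k4
    rw [mS] at k3 h1
    unfold ad at k4
    have e1 : y2 = y1 := by omega
    subst e1
    have : x2 = 1 ∨ x2 = p := by omega
    rcases this with rfl | rfl
    · exact Or.inr (Or.inr (Or.inl he))
    · exact Or.inr (Or.inr (Or.inr hf))

/-- `m = 3`, four agents, one type with two agents and two singletons -/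
lemma two_small {A T : Type*} [Fintype A] [Finite T] (t : A → T)
    (hn : Fintype.card A = 4) (a b : T) (hab : a ≠ b)
    (ha : cnt t a = 2) (hs : ∀ c, c ≠ a → cnt t c ≤ 1) :
    ∃ σ : A ↪ ZMod 3 × Fin 2, IsEquilibrium (cylinderGraph 3) t σ := by
  classical
  set S : Finset (ℕ × ℕ) := {(2, 0), (0, 1), (1, 1), (2, 1)} with hS
  have mS : ∀ x y, (x, y) ∈ S ↔ (x = 2 ∧ y = 0) ∨ (x = 0 ∧ y = 1) ∨ (x = 1 ∧ y = 1) ∨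
      (x = 2 ∧ y = 1) := by
    intro x y; simp [hS]
  set F : Finset (ℕ × ℕ) := {(2, 0), (0, 1)} with hF
  have mF : ∀ x y, (x, y) ∈ F ↔ (x = 2 ∧ y = 0) ∨ (x = 0 ∧ y = 1) := by
    intro x y; simp [hF]
  have c1 : F.card = 2 := by rw [hF, Finset.card_pair]; simp
  obtain ⟨g, hg⟩ := exists_conf (m := 3) t S F ∅ a b
    (by rintro ⟨x, y⟩ h; rw [mS] at h; simp only; omega)
    (by rw [hn, hS]; rfl)
    (by rintro ⟨x, y⟩ h; rw [mF] at h; rw [mS]; omega)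
    (by simp) (by simp) hab (by omega) (by simp)
  have un : ∀ x y x' y', (x, y) ∈ S → (x', y') ∈ S → ¬ (x = x' ∧ y = y') →
      ¬ ((x, y) ∈ F ∧ (x', y') ∈ F) → g (nd 3 x y) ≠ g (nd 3 x' y') := by
    intro x y x' y' h1 h2 h3 h4 h
    apply h4
    have h1' := (mS _ _).1 h1
    have h2' := (mS _ _).1 h2
    exact hg.uniq hs (by omega) (by rintro ⟨x, y⟩ h; rw [mF] at h; simp only; omega)
      (by omega) (by omega) (by omega) (by omega) h1 h3 h
  have fa : ∀ x y, (x, y) ∈ F → g (nd 3 x y) = some a := by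
    intro x y h
    have h' := (mF _ _).1 h
    exact hg.at1 (by omega) (by omega) h
  obtain ⟨e, he⟩ := hg.occ (x := 1) (y := 1) (by omega) (by omega) (by rw [mS]; omega)
  have fr : ∀ x1 y1 x2 y2, x1 < 3 → y1 < 2 → (x1, y1) ∉ S → (x2, y2) ∈ S → ad 3 x1 y1 x2 y2 →
      g (nd 3 x2 y2) = some a ∨ g (nd 3 x2 y2) = some e := by
    intro x1 y1 x2 y2 h1 h2 h3 h4 h5
    by_cases k : (x2, y2) ∈ F
    · exact Or.inl (fa _ _ k)
    · right
      rw [mF] at k; rw [mS] at h3 h4; unfold ad at h5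
      have e1 : x2 = 1 := by omega
      have e2 : y2 = 1 := by omega
      rw [e1, e2]; exact he
  apply conf_ok (by omega) hg
  intro x y x1 y1 hx hy hx1 hy1 h h1
  have h' := (mS _ _).1 h
  by_cases k : (x, y) ∈ F
  · right; left
    rw [fa x y k]
    refine ⟨?_, e, ?_⟩
    · rw [← fa x y k]
      have k' := (mF _ _).1 k
      refine ⟨2, 1, by omega, by omega, by rw [mS]; omega, by unfold ad; omega, ?_⟩
      apply un _ _ _ _ (by rw [mS]; omega) h (by omega)
      rw [mF, mF]; omega
    · intro x2 y2 k1 k2 k3 k4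
      exact Or.inr (fr x1 y1 x2 y2 hx1 hy1 h1 k3 k4)
  · right; right
    refine ⟨?_, a, e, ?_⟩
    · have k' := k
      rw [mF] at k'
      obtain ⟨u, v, hz⟩ : ∃ u v, (x = 1 ∧ u = 0 ∧ v = 1) ∨ (x = 2 ∧ u = 2 ∧ v = 0) := by
        by_cases hx1 : x = 1
        · exact ⟨0, 1, by omega⟩
        · exact ⟨2, 0, by omega⟩
      refine ⟨u, v, 3 - x, 1, by omega, by omega, by omega, by omega, by rw [mS]; omega,
        by rw [mS]; omega, by unfold ad; omega, by unfold ad; omega, ?_, ?_, ?_⟩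
      · apply un _ _ _ _ (by rw [mS]; omega) h (by omega)
        exact fun q => k q.2
      · apply un _ _ _ _ (by rw [mS]; omega) h (by omega)
        exact fun q => k q.2
      · apply un _ _ _ _ (by rw [mS]; omega) (by rw [mS]; omega) (by omega)
        rw [mF, mF]; omega
    · intro x2 y2 k1 k2 k3 k4
      exact Or.inr (Or.inr (fr x1 y1 x2 y2 hx1 hy1 h1 k3 k4))

/-- odd number of agents, balanced -/
lemma odd_bal {A T : Type*} [Fintype A] [Finite T] {m : ℕ} [NeZero m] (hm : 3 ≤ m) (t : A → T)
    (p : ℕ) (hp : 1 ≤ p) (hpm : p + 2 ≤ m) (hn : Fintype.card A = 2 * p + 1) (a b : T)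
    (hab : a ≠ b) (hle : cnt t a ≤ p + 1) (hmax : ∀ c, cnt t c ≤ cnt t a)
    (ha : 2 ≤ cnt t a) (hcase : p + 2 = m → 3 ≤ cnt t a) :
    ∃ σ : A ↪ ZMod m × Fin 2, IsEquilibrium (cylinderGraph m) t σ := by
  classical
  set S : Finset (ℕ × ℕ) := insert (p + 1, 0) (Finset.Icc 1 p ×ˢ Finset.range 2) with hS
  have mS : ∀ x y, (x, y) ∈ S ↔ (x = p + 1 ∧ y = 0) ∨ (1 ≤ x ∧ x ≤ p) ∧ y < 2 := by
    intro x y; simp [hS]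
  set F0 : Finset (ℕ × ℕ) := {(p + 1, 0), (p, 1)} with hF0
  set F : Finset (ℕ × ℕ) := if p + 2 = m then insert (1, 0) F0 else F0 with hF
  have mF : ∀ x y, (x, y) ∈ F ↔ (x = p + 1 ∧ y = 0) ∨ (x = p ∧ y = 1) ∨
      (p + 2 = m ∧ x = 1 ∧ y = 0) := by
    intro x y
    rw [hF]
    split_ifs with h
    · simp [hF0, h]; omega
    · simp [hF0, h]
  have cF : F.card ≤ cnt t a := by
    have : F0.card ≤ 2 := Finset.card_le_two
    rw [hF]
    split_ifs with h
    · have := Finset.card_insert_le (1, 0) F0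
      have := hcase h
      omega
    · omega
  obtain ⟨g, hg, hcol⟩ := exists_cols (m := m) t S F ∅ a b
    (by rintro ⟨x, y⟩ h; rw [mS] at h; simp only; omega)
    (by rw [hn, hS, Finset.card_insert_of_notMem (by simp)]; simp; ring)
    (by rintro ⟨x, y⟩ h; rw [mF] at h; rw [mS]; omega)
    (by simp) (by simp) hab cF (by simp) 1 p (by
      intro x h1 h2
      refine ⟨by rw [mS]; omega, by rw [mS]; omega, ?_⟩
      by_cases hx : x = p
      · refine ⟨0, by omega, ?_⟩
        rw [Finset.union_empty, mF]
        omega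
      · refine ⟨1, by omega, ?_⟩
        rw [Finset.union_empty, mF]
        omega)
  have fa : ∀ x y, x < m → y < 2 → (x, y) ∈ F → g (nd m x y) = some a := fun x y h1 h2 h3 =>
    hg.at1 h1 h2 h3
  have bi : ∀ x, 1 ≤ x → x ≤ p → g (nd m x 0) ≠ g (nd m x 1) := by
    intro x h1 h2 h
    obtain ⟨C, hC⟩ := hg.occ (x := x) (y := 0) (by omega) (by omega) (by rw [mS]; omega)
    have hC' := h ▸ hC
    have cc := fun E hE => count_cols hg.1 C 1 p x (by omega) (hcol x C h1 h2 hC hC') h1 h2 hC hC'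
      E hE
    by_cases ka : C = a
    · subst ka
      have := cc {(p + 1, 0)} (by
        intro q hq
        rw [Finset.mem_singleton] at hq
        subst hq
        exact ⟨by simp only; omega, by simp only; omega,
          fa _ _ (by simp only; omega) (by simp only; omega) (by simp only; rw [mF]; omega),
          by simp only; omega⟩)
      rw [Finset.card_singleton] at this
      omega
    · have := cc ∅ (by simp)
      rw [Finset.card_empty] at this
      have := hmax C
      have := cnt_add t ka
      omega
  apply conf_star hm hg
  · intro x y x1 y1 x2 y2 hx hy hx1 hy1 hx2 hy2 h0 h1 h2 k1 k2
    by_cases k : x1 = x2 ∧ y1 = y2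
    · exact Or.inl k
    · right
      rw [mS] at h0 h1 h2; unfold ad at k1 k2
      rw [fa x1 y1 hx1 hy1 (by rw [mF]; omega), fa x2 y2 hx2 hy2 (by rw [mF]; omega)]
  · intro x y hx hy hxy
    left
    rw [mS] at hxy
    by_cases hxp : x = p + 1
    · refine ⟨p, 0, by omega, by omega, by rw [mS]; omega, by unfold ad; omega, ?_⟩
      have := bi p (by omega) (by omega)
      rw [fa p 1 (by omega) (by omega) (by rw [mF]; omega)] at this
      rw [fa x y (by omega) (by omega) (by rw [mF]; omega)]
      exact this
    refine ⟨x, 1 - y, by omega, by omega, by rw [mS]; omega, by unfold ad; omega, ?_⟩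
    have := bi x (by omega) (by omega)
    have hy' : y = 0 ∨ y = 1 := by omega
    rcases hy' with rfl | rfl
    · exact this.symm
    · exact this

lemma Cfg.three_le {A T : Type*} [Fintype A] {m : ℕ} [NeZero m] {t : A → T}
    {g : ZMod m × Fin 2 → Option T} (hg : Cfg t g) {x y x' y' x'' y'' : ℕ} {c : T} (hx : x < m)
    (hy : y < 2) (hx' : x' < m) (hy' : y' < 2) (hx'' : x'' < m) (hy'' : y'' < 2)
    (h : g (nd m x y) = some c)
    (h' : g (nd m x' y') = some c) (h'' : g (nd m x'' y'') = some c)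
    (hne : ¬ (x = x' ∧ y = y')) (hne' : ¬ (x = x'' ∧ y = y'')) (hne'' : ¬ (x' = x'' ∧ y' = y'')) :
    3 ≤ cnt t c := by
  classical
  have := hg.le_cnt' c {(x, y), (x', y'), (x'', y'')} (by
    intro q hq
    rw [Finset.mem_insert, Finset.mem_insert, Finset.mem_singleton] at hq
    rcases hq with rfl | rfl | rfl
    · exact ⟨hx, hy, h⟩
    · exact ⟨hx', hy', h'⟩
    · exact ⟨hx'', hy'', h''⟩)
  rwa [Finset.card_eq_three.2 ⟨_, _, _, by simpa using hne, by simpa using hne',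
    by simpa using hne'', rfl⟩] at this

set_option maxHeartbeats 2000000 in
/-- staircase pairing: equal types occur only on diagonal partners -/
lemma exists_stair {A T : Type*} [Fintype A] [Finite T] {m : ℕ} [NeZero m] (t : A → T)
    (p : ℕ) (hp : 1 ≤ p) (hpm : p + 2 ≤ m) (hn : Fintype.card A = 2 * p + 1) (a b : T)
    (hab : a ≠ b) (hle : ∀ c, cnt t c ≤ 2) (ha : cnt t a = 2) :
    ∃ g, Conf m t (insert (p + 1, 0) (Finset.Icc 1 p ×ˢ Finset.range 2)) {(p + 1, 0), (p, 1)}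
      ∅ a b g ∧ ∀ x y x' y', (x, y) ∈ insert (p + 1, 0) (Finset.Icc 1 p ×ˢ Finset.range 2) →
        (x', y') ∈ insert (p + 1, 0) (Finset.Icc 1 p ×ˢ Finset.range 2) →
        g (nd m x y) = g (nd m x' y') → ¬ (x = x' ∧ y = y') → ¬ (x = 1 ∧ y = 0) →
        (y = 1 ∧ y' = 0 ∧ x' = x + 1) ∨ (y = 0 ∧ y' = 1 ∧ x' + 1 = x) := by
  classical
  set S : Finset (ℕ × ℕ) := insert (p + 1, 0) (Finset.Icc 1 p ×ˢ Finset.range 2) with hS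
  have mS : ∀ x y, (x, y) ∈ S ↔ (x = p + 1 ∧ y = 0) ∨ (1 ≤ x ∧ x ≤ p) ∧ y < 2 := by
    intro x y; simp [hS]
  set F : Finset (ℕ × ℕ) := {(p + 1, 0), (p, 1)} with hF
  have mF : ∀ x y, (x, y) ∈ F ↔ (x = p + 1 ∧ y = 0) ∨ (x = p ∧ y = 1) := by
    intro x y; simp [hF]
  have cF : F.card ≤ 2 := Finset.card_le_two
  obtain ⟨g, hg, hmax⟩ := exists_max _ (exists_conf (m := m) t S F ∅ a b
    (by rintro ⟨x, y⟩ h; rw [mS] at h; simp only; omega)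
    (by rw [hn, hS, Finset.card_insert_of_notMem (by simp)]; simp; ring)
    (by rintro ⟨x, y⟩ h; rw [mF] at h; rw [mS]; omega)
    (by simp) (by simp) hab (by omega) (by simp))
    (fun g => ((Finset.Icc 1 p).filter (fun j => g (nd m j 1) = g (nd m (j + 1) 0))).card)
  refine ⟨g, hg, ?_⟩
  intro x y x' y' h h' heq hne hx0
  have hq := (mS _ _).1 h
  have hq' := (mS _ _).1 h'
  obtain ⟨C, hC⟩ := hg.occ (x := x) (y := y) (by omega) (by omega) h
  have hC' : g (nd m x' y') = some C := heq ▸ hC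
  have h3 : ∀ u v, u < m → v < 2 → g (nd m u v) = some C → (u = x ∧ v = y) ∨ (u = x' ∧ v = y') := by
    intro u v hu hv huv
    by_contra k
    have := hg.1.three_le (by omega) (by omega) (by omega) (by omega) hu hv hC hC' huv hne
      (by omega) (by omega)
    have := hle C
    omega
  by_cases hCa : C = a
  · subst hCa
    have q1 := h3 (p + 1) 0 (by omega) (by omega) (hg.at1 (by omega) (by omega) (by rw [mF]; omega))
    have q2 := h3 p 1 (by omega) (by omega) (hg.at1 (by omega) (by omega) (by rw [mF]; omega))
    omega
  have nF : ¬ (x, y) ∈ F := fun k => hCa (by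
    have := hg.at1 (by omega) (by omega) k
    rw [hC] at this; exact Option.some.inj this)
  have nF' : ¬ (x', y') ∈ F := fun k => hCa (by
    have := hg.at1 (by omega) (by omega) k
    rw [hC'] at this; exact Option.some.inj this)
  have nq := nF
  have nq' := nF'
  rw [mF] at nq nq'
  obtain ⟨u, v, i, hi⟩ : ∃ u v i, (y = 1 ∧ u = x + 1 ∧ v = 0 ∧ i = x) ∨
      (y = 0 ∧ u + 1 = x ∧ v = 1 ∧ i + 1 = x) := by
    by_cases hy : y = 1
    · exact ⟨x + 1, 0, x, by omega⟩
    · exact ⟨x - 1, 1, x - 1, by omega⟩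
  by_contra hcon
  have huv : ¬ (u = x' ∧ v = y') := by
    clear hq hq' nq nq' hx0 hne; omega
  clear hcon
  have bx : x < m ∧ y < 2 := by
    clear hi hq' nq nq' hx0 hne huv; omega
  have bx' : x' < m ∧ y' < 2 := by
    clear hi hq nq nq' hx0 hne huv; omega
  clear hq' nq'
  have bu : (1 ≤ u ∧ u ≤ p) ∧ v < 2 ∧ ¬ (u = p ∧ v = 1) ∧ (1 ≤ i ∧ i ≤ p) := by
    clear hne huv bx bx'; omega
  clear hq nq hx0
  obtain ⟨bu1, bu2, bu3, hir⟩ := bu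
  have mu : (u, v) ∈ S := by rw [mS]; exact Or.inr ⟨bu1, bu2⟩
  have fu : (u, v) ∉ F := by
    rw [mF]; clear hi hne huv bx bx'; omega
  have bu : u < m ∧ v < 2 := ⟨by clear hi hne huv bx bx' bu3; omega, bu2⟩
  have xu : ¬ (x = u ∧ y = v) := by clear hne huv bx bx' bu3; omega
  have hm := hmax _ (hg.swap (u := nd m x' y') (v := nd m u v)
    (by rw [xc_nd bx'.1, yc_nd bx'.2]; exact h')
    (by rw [xc_nd bu.1, yc_nd bu.2]; exact mu)
    (by rw [xc_nd bx'.1, yc_nd bx'.2, Finset.union_empty]; exact nF')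
    (by rw [xc_nd bu.1, yc_nd bu.2, Finset.union_empty]; exact fu))
  set g' := g ∘ Equiv.swap (nd m x' y') (nd m u v) with hg'
  have e2 : g' (nd m u v) = some C := by simp [hg', hC']
  have e3 : ∀ z w, z < m → w < 2 → ¬ (z = x' ∧ w = y') → ¬ (z = u ∧ w = v) →
      g' (nd m z w) = g (nd m z w) := by
    intro z w hz hw k1 k2
    have z1 : nd m z w ≠ nd m x' y' := by
      intro h
      have a1 := congrArg xc h
      have a2 := congrArg yc h
      rw [xc_nd hz, xc_nd bx'.1] at a1
      rw [yc_nd hw, yc_nd bx'.2] at a2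
      omega
    have z2 : nd m z w ≠ nd m u v := by
      intro h
      have a1 := congrArg xc h
      have a2 := congrArg yc h
      rw [xc_nd hz, xc_nd bu.1] at a1
      rw [yc_nd hw, yc_nd bu.2] at a2
      omega
    simp [hg', Equiv.swap_apply_of_ne_of_ne z1 z2]
  have e1 : g' (nd m x y) = some C := by
    rw [e3 x y bx.1 bx.2 hne xu, hC]
  have hi' : g' (nd m i 1) = g' (nd m (i + 1) 0) := by
    rcases hi with ⟨r1, r2, r3, r4⟩ | ⟨r1, r2, r3, r4⟩
    · rw [r1] at e1; rw [r2, r3] at e2; rw [r4, e1, e2]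
    · rw [r4]
      have : i = u := by omega
      rw [this, ← r3, ← r1, e1, e2]
  have hin : ¬ g (nd m i 1) = g (nd m (i + 1) 0) := by
    intro k
    have guv : g (nd m u v) = some C := by
      rcases hi with ⟨r1, r2, r3, r4⟩ | ⟨r1, r2, r3, r4⟩
      · rw [r1] at hC; rw [r4, hC] at k; rw [r2, r3]; exact k.symm
      · have : i = u := by omega
        rw [r4, this, ← r3, ← r1, hC] at k; exact k
    have := h3 u v bu.1 bu.2 guv
    omega
  refine absurd hm (not_le.2 (Finset.card_lt_card ?_))
  rw [Finset.ssubset_iff_of_subset]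
  · refine ⟨i, ?_, ?_⟩
    · simp only [Finset.mem_filter, Finset.mem_Icc]
      exact ⟨by omega, hi'⟩
    · simp only [Finset.mem_filter, not_and]
      exact fun _ => hin
  · intro j hj
    simp only [Finset.mem_filter, Finset.mem_Icc] at hj ⊢
    refine ⟨hj.1, ?_⟩
    by_cases k1 : j = i
    · subst k1; exact hi'
    have n1 : ¬ (j = x' ∧ 1 = y') := by
      rintro ⟨r1, r2⟩
      have := hj.2
      rw [← r2] at hC'
      rw [r1, hC'] at this
      have := h3 (x' + 1) 0 (by omega) (by omega) this.symm
      omega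
    have n2 : ¬ (j + 1 = x' ∧ 0 = y') := by
      rintro ⟨r1, r2⟩
      have := hj.2
      rw [r1, r2, hC'] at this
      have := h3 j 1 (by omega) (by omega) this
      omega
    rw [e3 j 1 (by omega) (by omega) n1 (by omega),
      e3 (j + 1) 0 (by omega) (by omega) n2 (by omega)]
    exact hj.2

/-- odd number of agents, three empty nodes, all types with at most two agents -/
lemma odd_stair {A T : Type*} [Fintype A] [Finite T] {m : ℕ} [NeZero m] (hm : 3 ≤ m) (t : A → T)
    (p : ℕ) (hp : 1 ≤ p) (hpm : p + 2 = m) (hn : Fintype.card A = 2 * p + 1) (a b : T)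
    (hab : a ≠ b) (hle : ∀ c, cnt t c ≤ 2) (ha : cnt t a = 2) :
    ∃ σ : A ↪ ZMod m × Fin 2, IsEquilibrium (cylinderGraph m) t σ := by
  classical
  obtain ⟨g, hg, hun⟩ := exists_stair (m := m) t p hp (by omega) hn a b hab hle ha
  set S : Finset (ℕ × ℕ) := insert (p + 1, 0) (Finset.Icc 1 p ×ˢ Finset.range 2) with hS
  have mS : ∀ x y, (x, y) ∈ S ↔ (x = p + 1 ∧ y = 0) ∨ (1 ≤ x ∧ x ≤ p) ∧ y < 2 := by
    intro x y; simp [hS]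
  have un : ∀ x y x' y', (x, y) ∈ S → (x', y') ∈ S → ¬ (x = x' ∧ y = y') →
      ¬ (y = 1 ∧ y' = 0 ∧ x' = x + 1) → ¬ (y = 0 ∧ y' = 1 ∧ x' + 1 = x) →
      g (nd m x y) ≠ g (nd m x' y') := by
    intro x y x' y' h h' h1 h2 h3 heq
    by_cases k : x = 1 ∧ y = 0
    · have := hun x' y' x y h' h heq.symm (by omega) (by omega)
      omega
    · have := hun x y x' y' h h' heq h1 k
      omega
  have f1 : g (nd m (p + 1) 0) = some a := hg.at1 (by omega) (by omega) (by simp)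
  have f2 : g (nd m p 1) = some a := hg.at1 (by omega) (by omega) (by simp)
  have one : ∀ x y, x < m → y < 2 → (x, y) ∈ S → ∃ x2 y2, x2 < m ∧ y2 < 2 ∧ (x2, y2) ∈ S ∧
      ad m x y x2 y2 ∧ g (nd m x2 y2) ≠ g (nd m x y) := by
    intro x y hx hy h
    have h' := (mS _ _).1 h
    by_cases k : x = p + 1
    · refine ⟨p, 0, by omega, by omega, by rw [mS]; omega, by unfold ad; omega, ?_⟩
      exact un _ _ _ _ (by rw [mS]; omega) h (by omega) (by omega) (by omega)
    · refine ⟨x, 1 - y, by omega, by omega, by rw [mS]; omega, by unfold ad; omega, ?_⟩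
      exact un _ _ _ _ (by rw [mS]; omega) h (by omega) (by omega) (by omega)
  obtain ⟨e, he⟩ := hg.occ (x := 1) (y := 0) (by omega) (by omega) (by rw [mS]; omega)
  obtain ⟨f, hf⟩ := hg.occ (x := 1) (y := 1) (by omega) (by omega) (by rw [mS]; omega)
  apply conf_ok (by omega) hg
  intro x y x1 y1 hx hy hx1 hy1 h h1
  have h' := (mS _ _).1 h
  have h1' := h1
  rw [mS] at h1'
  by_cases hw1 : x1 = p + 1
  · right; left
    refine ⟨one x y hx hy h, a, ?_⟩
    intro x2 y2 k1 k2 k3 k4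
    rw [mS] at k3; unfold ad at k4
    right; right
    have : (x2 = p + 1 ∧ y2 = 0) ∨ (x2 = p ∧ y2 = 1) := by omega
    rcases this with ⟨rfl, rfl⟩ | ⟨rfl, rfl⟩
    · exact f1
    · exact f2
  by_cases hw2 : y1 = 1
  · right; left
    refine ⟨one x y hx hy h, f, ?_⟩
    intro x2 y2 k1 k2 k3 k4
    rw [mS] at k3; unfold ad at k4
    right; right
    have e1 : x2 = 1 := by omega
    have e2 : y2 = 1 := by omega
    rw [e1, e2]; exact hf
  -- now the empty node is `(0, 0)`
  have fr : ∀ x2 y2, x2 < m → y2 < 2 → (x2, y2) ∈ S → ad m x1 y1 x2 y2 →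
      (x2 = p + 1 ∧ y2 = 0) ∨ (x2 = 1 ∧ y2 = 0) := by
    intro x2 y2 k1 k2 k3 k4
    rw [mS] at k3; unfold ad at k4
    omega
  by_cases hv1 : x = 1 ∧ y = 0
  · right; left
    refine ⟨one x y hx hy h, a, ?_⟩
    intro x2 y2 k1 k2 k3 k4
    rcases fr x2 y2 k1 k2 k3 k4 with ⟨rfl, rfl⟩ | q
    · exact Or.inr (Or.inr f1)
    · left; omega
  by_cases hv2 : (x = p + 1 ∧ y = 0) ∨ (x = p ∧ y = 1)
  · right; left
    refine ⟨one x y hx hy h, e, ?_⟩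
    have hxa : g (nd m x y) = some a := by
      rcases hv2 with ⟨rfl, rfl⟩ | ⟨rfl, rfl⟩
      · exact f1
      · exact f2
    intro x2 y2 k1 k2 k3 k4
    rcases fr x2 y2 k1 k2 k3 k4 with ⟨rfl, rfl⟩ | ⟨rfl, rfl⟩
    · right; left; rw [f1, hxa]
    · exact Or.inr (Or.inr he)
  right; right
  refine ⟨?_, e, a, ?_⟩
  · by_cases hx1 : x = 1
    · refine ⟨1, 0, 2, 1, by omega, by omega, by omega, by omega, by rw [mS]; omega,
        by rw [mS]; omega, by unfold ad; omega, by unfold ad; omega, ?_, ?_, ?_⟩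
      · exact un _ _ _ _ (by rw [mS]; omega) h (by omega) (by omega) (by omega)
      · exact un _ _ _ _ (by rw [mS]; omega) h (by omega) (by omega) (by omega)
      · exact un _ _ _ _ (by rw [mS]; omega) (by rw [mS]; omega) (by omega) (by omega) (by omega)
    · refine ⟨x - 1, y, x + 1, y, by omega, by omega, by omega, by omega, by rw [mS]; omega,
        by rw [mS]; omega, by unfold ad; omega, by unfold ad; omega, ?_, ?_, ?_⟩
      · exact un _ _ _ _ (by rw [mS]; omega) h (by omega) (by omega) (by omega)
      · exact un _ _ _ _ (by rw [mS]; omega) h (by omega) (by omega) (by omega)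
      · exact un _ _ _ _ (by rw [mS]; omega) (by rw [mS]; omega) (by omega) (by omega) (by omega)
  · intro x2 y2 k1 k2 k3 k4
    rcases fr x2 y2 k1 k2 k3 k4 with ⟨rfl, rfl⟩ | ⟨rfl, rfl⟩
    · exact Or.inr (Or.inr (Or.inr f1))
    · exact Or.inr (Or.inr (Or.inl he))
/-- Every jump game whose graph is a cylinder (2 × m grid whose
rows are cycles, m ≥ 3) admits an equilibrium assignment. -/
theorem stmt_7 {A T : Type*} [Fintype A] [Fintype T]
    (m : ℕ) (hm : 3 ≤ m)
    (hA : 2 ≤ Fintype.card A) (hVA : Fintype.card A < 2 * m)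
    (t : A → T) (ht : Function.Surjective t) (hT : 2 ≤ Fintype.card T) :
    ∃ σ : A ↪ ZMod m × Fin 2, IsEquilibrium (cylinderGraph m) t σ := by
  classical
  have : NeZero m := ⟨by omega⟩
  have hV : Fintype.card (ZMod m × Fin 2) = 2 * m := by
    rw [Fintype.card_prod, ZMod.card, Fintype.card_fin]; ring
  by_cases h1 : Fintype.card A + 1 = 2 * m
  · exact equil_one _ t (by rw [hV, h1])
  by_cases hinj : Function.Injective t
  · exact equil_inj _ t hinj (by rw [hV]; omega)
  have hbig : ∃ c, 2 ≤ cnt t c := by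
    simp only [Function.Injective, not_forall] at hinj
    obtain ⟨i, j, hij, hne⟩ := hinj
    refine ⟨t i, ?_⟩
    unfold cnt
    rw [← Finset.card_pair hne]
    apply Finset.card_le_card
    intro k hk
    rw [Finset.mem_insert, Finset.mem_singleton] at hk
    rw [Finset.mem_filter]
    rcases hk with rfl | rfl
    · exact ⟨Finset.mem_univ _, rfl⟩
    · exact ⟨Finset.mem_univ _, hij.symm⟩
  obtain ⟨c0, hc0⟩ := hbig
  obtain ⟨a, -, hmax⟩ := exists_max (fun _ : T => True) ⟨c0, trivial⟩ (cnt t)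
  replace hmax : ∀ c, cnt t c ≤ cnt t a := fun c => hmax c trivial
  have ha2 : 2 ≤ cnt t a := hc0.trans (hmax c0)
  obtain ⟨b0, hb0⟩ : ∃ b, b ≠ a := by
    have : Nontrivial T := Fintype.one_lt_card_iff_nontrivial.1 (by omega)
    exact exists_ne a
  obtain ⟨b, hba, hbmax⟩ := exists_max (fun c : T => c ≠ a) ⟨b0, hb0⟩ (cnt t)
  have hab : a ≠ b := hba.symm
  have hb1 := cnt_pos ht b
  have hsum := cnt_add t hab
  rcases Nat.even_or_odd' (Fintype.card A) with ⟨p, hp | hp⟩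
  · by_cases hd : p + 1 ≤ cnt t a
    · by_cases hp3 : 3 ≤ p
      · exact even_dom hm t p hp3 (by omega) hp a b hab hd
      · have : p = 2 := by omega
        subst this
        exact even_four hm t (by omega) a b hab (by omega)
    · have hle : ∀ c, cnt t c ≤ p := fun c => (hmax c).trans (by omega)
      by_cases hpm : p + 2 ≤ m
      · exact even_bal hm t p hpm hp a b hab hle
      have hpm' : p + 1 = m := by omega
      by_cases hb2 : 2 ≤ cnt t b
      · exact two_bal hm t p hpm' hp a b hab hle hb2 (hmax b) hbmax
      have hs : ∀ c, c ≠ a → cnt t c ≤ 1 := fun c hc => (hbmax c hc).trans (by omega)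
      by_cases h4 : 4 ≤ cnt t a
      · exact two_four hm t p hpm' hp a b hab h4 hs
      by_cases h3 : cnt t a = 3
      · exact two_three (by omega) t p hpm' hp a b hab h3 hs
      have h2 : cnt t a = 2 := by omega
      by_cases hm4 : 4 ≤ m
      · exact two_two hm4 t p hpm' hp a b hab h2 hs
      have : m = 3 := by omega
      subst this
      exact two_small t (by omega) a b hab h2 hs
  · by_cases hd : p + 2 ≤ cnt t a
    · exact odd_dom hm t p (by omega) (by omega) hp a b hab hd
    by_cases hcase : p + 2 = m → 3 ≤ cnt t a
    · exact odd_bal hm t p (by omega) (by omega) hp a b hab (by omega) hmax ha2 hcase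
    · rw [Classical.not_imp] at hcase
      exact odd_stair hm t p (by omega) hcase.1 hp a b hab
        (fun c => (hmax c).trans (by omega)) (by omega)
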